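/- arXiv:2311.18283 — 2 statements merged into one kernel-verified Lean document; each statement's English description precedes it below -/
import Mathlib

section
/- Let 0 < α < 1, λ > 0, κ > 0, β > 1 and c > 0. Let H(x) = c x^β for x ≥ 0 and H(x) = 0 for x ≤ 0, and let f(t) = 1 for t ∈ [0,1] (and f(t) = 0 for t > 1). For γ > 0, let r_γ be the continuous solution of r_γ(t) = H(κ ∫₀ᵗ λ⁻¹ (t−s)^{−α} (γ f(s) − r_γ(s)) ds), and define MI(γ,t) = κ ∫₀ᵗ (1 + λ⁻¹ (t−s)^{−α}) (γ f(s) − r_γ(s)) ds. Then for every fixed 0 < t < 1, MI(γ,t) / (γ^{1/β} c^{−1/β} (1 + (λ / (α Γ(1−α) Γ(α))) t^α)) → 1 as γ → ∞, where Γ is the Gamma function. -/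
open MeasureTheory Set Filter Topology

/-- The Beta integral `B(1 - α, α)`. -/
lemma setIntegral_beta {α : ℝ} (hα0 : 0 < α) (hα1 : α < 1) :
    ∫ z in Ioo (0:ℝ) 1, z ^ (-α) * (1 - z) ^ (α - 1) =
      Real.Gamma (1 - α) * Real.Gamma α := by
  have h := ProbabilityTheory.beta_eq_betaIntegralReal (1 - α) α (by linarith) hα0
  rw [ProbabilityTheory.beta, sub_add_cancel, Real.Gamma_one, div_one] at h
  rw [h, Complex.betaIntegral, intervalIntegral.integral_of_le zero_le_one,
    ← integral_Ioc_eq_integral_Ioo, ← RCLike.re_eq_complex_re, ← integral_re]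
  · refine setIntegral_congr_fun measurableSet_Ioc fun z hz => ?_
    have h1 : (0:ℝ) ≤ 1 - z := by linarith [hz.2]
    have e1 : ((1 - α : ℝ) : ℂ) - 1 = ((-α : ℝ) : ℂ) := by push_cast; ring
    have e2 : (α : ℂ) - 1 = ((α - 1 : ℝ) : ℂ) := by push_cast; ring
    have e3 : (1 : ℂ) - z = ((1 - z : ℝ) : ℂ) := by push_cast; ring
    simp only [RCLike.re_eq_complex_re]
    rw [e1, e2, e3, ← Complex.ofReal_cpow hz.1.le, ← Complex.ofReal_cpow h1,
      ← Complex.ofReal_mul, Complex.ofReal_re]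
  · have := Complex.betaIntegral_convergent (u := ((1 - α : ℝ) : ℂ)) (v := (α : ℂ))
      (by simpa using hα1) (by simpa using hα0)
    exact (intervalIntegrable_iff_integrableOn_Ioc_of_le zero_le_one).1 this

/-- The Abel kernels `x ^ (α - 1)` and `x ^ (-α)` convolve to a constant. -/
lemma setIntegral_abel {α u b : ℝ} (hα0 : 0 < α) (hα1 : α < 1) (hub : u < b) :
    ∫ s in Ioo u b, (b - s) ^ (α - 1) * (s - u) ^ (-α) =
      Real.Gamma (1 - α) * Real.Gamma α := by
  have hb : 0 < b - u := sub_pos.2 hub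
  have himg : (fun s => (s - u) / (b - u)) '' Ioo u b = Ioo 0 1 := by
    ext z
    constructor
    · rintro ⟨s, ⟨h1, h2⟩, rfl⟩
      exact ⟨div_pos (by linarith) hb, (div_lt_one hb).2 (by linarith)⟩
    · rintro ⟨h1, h2⟩
      refine ⟨u + z * (b - u), ⟨by nlinarith, by nlinarith⟩, ?_⟩
      simp only
      field_simp
      ring
  have hinj : InjOn (fun s => (s - u) / (b - u)) (Ioo u b) := by
    intro x _ y _ hxy
    simp only at hxy
    rw [div_left_inj' hb.ne'] at hxy
    linarith
  have hder : ∀ s ∈ Ioo u b,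
      HasDerivWithinAt (fun s => (s - u) / (b - u)) (1 / (b - u)) (Ioo u b) s := fun s _ =>
    (((hasDerivAt_id s).sub_const u).div_const (b - u)).hasDerivWithinAt
  rw [← setIntegral_beta hα0 hα1, ← himg,
    integral_image_eq_integral_abs_deriv_smul measurableSet_Ioo hder hinj]
  refine setIntegral_congr_fun measurableSet_Ioo fun s hs => ?_
  have h1 : 0 < s - u := sub_pos.2 hs.1
  have h2 : 0 < b - s := sub_pos.2 hs.2
  have e : 1 - (s - u) / (b - u) = (b - s) / (b - u) := by field_simp; ring
  simp only [smul_eq_mul]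
  rw [e, abs_of_pos (by positivity), Real.div_rpow h1.le hb.le, Real.div_rpow h2.le hb.le,
    Real.rpow_neg hb.le, Real.rpow_sub_one hb.ne']
  have : 0 < (b - u) ^ α := Real.rpow_pos_of_pos hb α
  field_simp

/-- The kernel expressing the free continuation past `a` of an Abel transform
through its values on `(0, a)`, evaluated at time `t` (up to normalization). -/
noncomputable def abelPoisson (α a t s : ℝ) : ℝ :=
  (t - a) ^ (1 - α) * ((a - s) ^ (α - 1) / (t - s))

lemma setIntegral_abelPoisson {α u a t : ℝ} (hα0 : 0 < α) (hα1 : α < 1) (hua : u < a)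
    (hat : a < t) :
    ∫ s in Ioo u a, abelPoisson α a t s * (s - u) ^ (-α) =
      Real.Gamma (1 - α) * Real.Gamma α * (t - u) ^ (-α) := by
  have hb : 0 < a - u := sub_pos.2 hua
  have hh : 0 < t - a := sub_pos.2 hat
  have ht : 0 < t - u := by linarith
  set φ : ℝ → ℝ := fun s => (t - a) * (s - u) / ((a - u) * (t - s)) with hφ
  have himg : φ '' Ioo u a = Ioo 0 1 := by
    ext z
    constructor
    · rintro ⟨s, ⟨h1, h2⟩, rfl⟩
      have h3 : 0 < t - s := by linarith
      have h4 : 0 < s - u := by linarith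
      refine ⟨by simp only [hφ]; positivity, (div_lt_one (by positivity)).2 (by nlinarith)⟩
    · rintro ⟨h1, h2⟩
      have hd : 0 < (t - a) + z * (a - u) := by positivity
      refine ⟨(z * (a - u) * t + (t - a) * u) / ((t - a) + z * (a - u)), ⟨?_, ?_⟩, ?_⟩
      · rw [lt_div_iff₀ hd]
        nlinarith [mul_pos (mul_pos h1 hb) ht]
      · rw [div_lt_iff₀ hd]
        nlinarith [mul_pos (mul_pos (sub_pos.2 h2) hb) hh]
      · have e1 : (z * (a - u) * t + (t - a) * u) / ((t - a) + z * (a - u)) - u =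
            z * (a - u) * (t - u) / ((t - a) + z * (a - u)) := by
          field_simp; ring
        have e2 : t - (z * (a - u) * t + (t - a) * u) / ((t - a) + z * (a - u)) =
            (t - a) * (t - u) / ((t - a) + z * (a - u)) := by
          field_simp; ring
        simp only [hφ]
        rw [e1, e2]
        field_simp
  have hinj : InjOn φ (Ioo u a) := by
    intro x hx y hy hxy
    have h1 : 0 < t - x := by linarith [hx.2]
    have h2 : 0 < t - y := by linarith [hy.2]
    simp only [hφ] at hxy
    rw [div_eq_div_iff (by positivity) (by positivity)] at hxy
    have h3 : (t - a) * (a - u) * (t - u) * (x - y) = 0 := by linear_combination hxy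
    have h4 : (t - a) * (a - u) * (t - u) ≠ 0 := by positivity
    have := (mul_eq_zero.1 h3).resolve_left h4
    linarith
  have hder : ∀ s ∈ Ioo u a, HasDerivWithinAt φ
      ((t - a) * (t - u) / ((a - u) * (t - s) ^ 2)) (Ioo u a) s := by
    intro s hs
    have h1 : 0 < t - s := by linarith [hs.2]
    have hn : HasDerivAt (fun s => (t - a) * (s - u)) ((t - a) * 1) s :=
      ((hasDerivAt_id s).sub_const u).const_mul (t - a)
    have hd : HasDerivAt (fun s => (a - u) * (t - s)) ((a - u) * (-1)) s :=
      ((hasDerivAt_id s).const_sub t).const_mul (a - u)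
    refine ((hn.div hd (by positivity)).congr_deriv ?_).hasDerivWithinAt
    field_simp
    ring
  rw [← setIntegral_beta hα0 hα1, ← himg,
    integral_image_eq_integral_abs_deriv_smul measurableSet_Ioo hder hinj, ← integral_mul_const]
  refine setIntegral_congr_fun measurableSet_Ioo fun s hs => ?_
  have h1 : 0 < s - u := sub_pos.2 hs.1
  have h2 : 0 < a - s := sub_pos.2 hs.2
  have h3 : 0 < t - s := by linarith
  have e : 1 - φ s = (t - u) * (a - s) / ((a - u) * (t - s)) := by
    simp only [hφ]; field_simp; ring
  simp only [smul_eq_mul]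
  rw [e, abs_of_pos (by positivity), abelPoisson]
  simp only [hφ]
  rw [Real.div_rpow (by positivity) (by positivity), Real.div_rpow (by positivity) (by positivity),
    Real.mul_rpow hh.le h1.le, Real.mul_rpow hb.le h3.le, Real.mul_rpow ht.le h2.le,
    Real.mul_rpow hb.le h3.le, Real.rpow_neg hb.le, Real.rpow_neg h3.le, Real.rpow_neg ht.le,
    Real.rpow_sub_one hb.ne', Real.rpow_sub_one h3.ne', Real.rpow_sub_one ht.ne',
    sub_eq_neg_add 1 α, Real.rpow_add_one hh.ne']
  have p1 : 0 < (a - u) ^ α := Real.rpow_pos_of_pos hb α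
  have p2 : 0 < (t - s) ^ α := Real.rpow_pos_of_pos h3 α
  have p3 : 0 < (t - u) ^ α := Real.rpow_pos_of_pos ht α
  field_simp

/-- Fubini for an Abel transform integrated against a nonnegative kernel `Q`. -/
lemma setIntegral_mul_abelTransform {α a : ℝ} {Q v g : ℝ → ℝ} (hQm : Measurable Q)
    (hQ0 : ∀ s ∈ Ioo 0 a, 0 ≤ Q s)
    (hQint : ∀ u ∈ Ioo 0 a, IntegrableOn (fun s => Q s * (s - u) ^ (-α)) (Ioo u a))
    (hg : ∀ u ∈ Ioo 0 a, ∫ s in Ioo u a, Q s * (s - u) ^ (-α) = g u)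
    (hv : IntegrableOn v (Ioo 0 a)) (hgv : IntegrableOn (fun u => g u * v u) (Ioo 0 a)) :
    IntegrableOn (fun s => Q s * ∫ u in Ioo 0 s, (s - u) ^ (-α) * v u) (Ioo 0 a) ∧
      ∫ s in Ioo 0 a, Q s * ∫ u in Ioo 0 s, (s - u) ^ (-α) * v u =
        ∫ u in Ioo 0 a, g u * v u := by
  set μ := (volume : Measure ℝ).restrict (Ioo 0 a) with hμ
  set F : ℝ × ℝ → ℝ := indicator {p | p.2 < p.1}
    (fun p => Q p.1 * (p.1 - p.2) ^ (-α) * v p.2) with hF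
  have hFm : AEStronglyMeasurable F (μ.prod μ) := by
    refine AEStronglyMeasurable.indicator ?_ (measurableSet_lt measurable_snd measurable_fst)
    refine AEStronglyMeasurable.mul ?_ hv.1.comp_snd
    exact (by fun_prop : Measurable fun p : ℝ × ℝ => Q p.1 * (p.1 - p.2) ^ (-α)).aestronglyMeasurable
  have hFu : ∀ u, (fun s => F (s, u)) =
      (Ioi u).indicator (fun s => Q s * (s - u) ^ (-α) * v u) := by
    intro u; ext s; simp [hF, indicator]
  have hFs : ∀ s, (fun u => F (s, u)) =
      (Iio s).indicator (fun u => Q s * ((s - u) ^ (-α) * v u)) := by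
    intro s; ext u; simp [hF, indicator, mul_assoc]
  have hinter : ∀ u ∈ Ioo 0 a, Ioo 0 a ∩ Ioi u = Ioo u a := by
    intro u hu; ext s; simp only [mem_inter_iff, mem_Ioo, mem_Ioi]
    exact ⟨fun h => ⟨h.2, h.1.2⟩, fun h => ⟨⟨hu.1.trans h.1, h.2⟩, h.1⟩⟩
  have hinter' : ∀ s ∈ Ioo 0 a, Ioo 0 a ∩ Iio s = Ioo 0 s := by
    intro s hs; ext u; simp only [mem_inter_iff, mem_Ioo, mem_Iio]
    exact ⟨fun h => ⟨h.1.1, h.2⟩, fun h => ⟨⟨h.1, h.2.trans hs.2⟩, h.2⟩⟩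
  have hIu : ∀ u ∈ Ioo 0 a, ∫ s, F (s, u) ∂μ = g u * v u := by
    intro u hu
    rw [hFu, hμ, setIntegral_indicator measurableSet_Ioi, hinter u hu, integral_mul_const, hg u hu]
  have hIs : ∀ s ∈ Ioo 0 a, ∫ u, F (s, u) ∂μ = Q s * ∫ u in Ioo 0 s, (s - u) ^ (-α) * v u := by
    intro s hs
    rw [hFs, hμ, setIntegral_indicator measurableSet_Iio, hinter' s hs, integral_const_mul]
  have hFi : Integrable F (μ.prod μ) := by
    rw [integrable_prod_iff' hFm]
    constructor
    · refine (ae_restrict_iff' measurableSet_Ioo).2 (ae_of_all _ fun u hu => ?_)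
      rw [hFu, hμ, integrable_indicator_iff measurableSet_Ioi, IntegrableOn,
        Measure.restrict_restrict measurableSet_Ioi, inter_comm, hinter u hu]
      exact (hQint u hu).mul_const _
    · refine Integrable.congr hgv.norm ?_
      refine (ae_restrict_iff' measurableSet_Ioo).2 (ae_of_all _ fun u hu => ?_)
      have hn : (fun s => ‖F (s, u)‖) =
          (Ioi u).indicator (fun s => ‖Q s * (s - u) ^ (-α) * v u‖) := by
        ext s
        rw [congrFun (hFu u) s, norm_indicator_eq_indicator_norm]
      have hn' : ∫ s in Ioo u a, ‖Q s * (s - u) ^ (-α) * v u‖ =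
          ∫ s in Ioo u a, Q s * (s - u) ^ (-α) * ‖v u‖ := by
        refine setIntegral_congr_fun measurableSet_Ioo fun s hs => ?_
        rw [norm_mul, Real.norm_of_nonneg (mul_nonneg (hQ0 s ⟨hu.1.trans hs.1, hs.2⟩)
          (Real.rpow_nonneg (sub_nonneg.2 hs.1.le) _))]
      have hg0 : 0 ≤ g u := by
        rw [← hg u hu]
        exact setIntegral_nonneg measurableSet_Ioo fun s hs =>
          mul_nonneg (hQ0 s ⟨hu.1.trans hs.1, hs.2⟩) (Real.rpow_nonneg (sub_nonneg.2 hs.1.le) _)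
      simp only
      rw [hn, hμ, setIntegral_indicator measurableSet_Ioi, hinter u hu, hn', integral_mul_const,
        hg u hu, norm_mul, Real.norm_of_nonneg hg0]
  refine ⟨?_, ?_⟩
  · refine Integrable.congr hFi.integral_prod_left ?_
    exact (ae_restrict_iff' measurableSet_Ioo).2 (ae_of_all _ fun s hs => hIs s hs)
  · rw [← setIntegral_congr_fun measurableSet_Ioo hIs, ← setIntegral_congr_fun measurableSet_Ioo hIu]
    exact integral_integral_swap (f := fun s u => F (s, u)) hFi

section Kernels

variable {α : ℝ}

lemma gamma_mul_gamma_pos (hα0 : 0 < α) (hα1 : α < 1) :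
    0 < Real.Gamma (1 - α) * Real.Gamma α :=
  mul_pos (Real.Gamma_pos_of_pos (by linarith)) (Real.Gamma_pos_of_pos hα0)

lemma integrableOn_of_setIntegral_pos {f : ℝ → ℝ} {s : Set ℝ} (h : 0 < ∫ x in s, f x) :
    IntegrableOn f s :=
  not_imp_comm.1 integral_undef h.ne'

lemma integrableOn_abel {u b : ℝ} (hα0 : 0 < α) (hα1 : α < 1) (hub : u < b) :
    IntegrableOn (fun s => (b - s) ^ (α - 1) * (s - u) ^ (-α)) (Ioo u b) :=
  integrableOn_of_setIntegral_pos <|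
    (setIntegral_abel hα0 hα1 hub).symm ▸ gamma_mul_gamma_pos hα0 hα1

lemma integrableOn_abelPoisson_mul {u a t : ℝ} (hα0 : 0 < α) (hα1 : α < 1) (hua : u < a)
    (hat : a < t) :
    IntegrableOn (fun s => abelPoisson α a t s * (s - u) ^ (-α)) (Ioo u a) :=
  integrableOn_of_setIntegral_pos <| (setIntegral_abelPoisson hα0 hα1 hua hat).symm ▸
    mul_pos (gamma_mul_gamma_pos hα0 hα1) (Real.rpow_pos_of_pos (by linarith) _)

lemma abelPoisson_nonneg {a t s : ℝ} (hat : a ≤ t) (hs : s ≤ a) : 0 ≤ abelPoisson α a t s :=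
  mul_nonneg (Real.rpow_nonneg (sub_nonneg.2 hat) _)
    (div_nonneg (Real.rpow_nonneg (sub_nonneg.2 hs) _) (by linarith))

lemma measurable_abelPoisson {a t : ℝ} : Measurable (abelPoisson α a t) := by
  unfold abelPoisson
  fun_prop

lemma intervalIntegrable_sub_rpow {ρ t a b : ℝ} (hρ : -1 < ρ) :
    IntervalIntegrable (fun s => (t - s) ^ ρ) volume a b := by
  have := (intervalIntegral.intervalIntegrable_rpow' (a := t - a) (b := t - b) hρ).comp_sub_left t
  simpa using this

lemma integrableOn_sub_rpow {ρ t a b : ℝ} (hρ : -1 < ρ) (hab : a ≤ b) :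
    IntegrableOn (fun s => (t - s) ^ ρ) (Ioo a b) :=
  (intervalIntegrable_iff_integrableOn_Ioo_of_le hab).1 (intervalIntegrable_sub_rpow hρ)

lemma setIntegral_sub_rpow {ρ t : ℝ} (hρ : 0 < ρ) (ht : 0 ≤ t) :
    ∫ s in Ioo 0 t, (t - s) ^ (ρ - 1) = t ^ ρ / ρ := by
  rw [← integral_Ioc_eq_integral_Ioo, ← intervalIntegral.integral_of_le ht,
    intervalIntegral.integral_comp_sub_left (fun x => x ^ (ρ - 1)) t, sub_self, sub_zero,
    integral_rpow (Or.inl (by linarith))]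
  simp [Real.zero_rpow hρ.ne']

/-- Continuation past `a` of an Abel transform whose density is cut off after `a`. -/
lemma setIntegral_abelPoisson_mul_transform {a t : ℝ} {v : ℝ → ℝ} (hα0 : 0 < α) (hα1 : α < 1)
    (hat : a < t) (hv : IntegrableOn v (Ioo 0 a)) :
    IntegrableOn (fun s => abelPoisson α a t s * ∫ u in Ioo 0 s, (s - u) ^ (-α) * v u)
        (Ioo 0 a) ∧
      ∫ s in Ioo 0 a, abelPoisson α a t s * ∫ u in Ioo 0 s, (s - u) ^ (-α) * v u =
        Real.Gamma (1 - α) * Real.Gamma α * ∫ u in Ioo 0 a, (t - u) ^ (-α) * v u := by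
  have h := setIntegral_mul_abelTransform (α := α) (a := a) (v := v)
    (g := fun u => Real.Gamma (1 - α) * Real.Gamma α * (t - u) ^ (-α))
    (measurable_abelPoisson (α := α) (a := a) (t := t))
    (fun s hs => abelPoisson_nonneg hat.le hs.2.le)
    (fun u hu => integrableOn_abelPoisson_mul hα0 hα1 hu.2 hat)
    (fun u hu => setIntegral_abelPoisson hα0 hα1 hu.2 hat) hv ?_
  · refine ⟨h.1, h.2.trans ?_⟩
    rw [← integral_const_mul]
    simp only [mul_assoc]
  · simp only [mul_assoc]
    refine Integrable.const_mul ?_ _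
    refine Integrable.const_mul ?_ _
    refine Integrable.bdd_mul (c := (t - a) ^ (-α)) hv
      (by fun_prop : Measurable fun u : ℝ => (t - u) ^ (-α)).aestronglyMeasurable ?_
    refine (ae_restrict_iff' measurableSet_Ioo).2 (ae_of_all _ fun u hu => ?_)
    have h1 : 0 < t - a := sub_pos.2 hat
    have h2 : t - a ≤ t - u := by linarith [hu.2]
    rw [Real.norm_of_nonneg (Real.rpow_nonneg (h1.le.trans h2) _)]
    exact Real.rpow_le_rpow_of_nonpos h1 h2 (by linarith)

/-- Abel inversion, in integrated form. -/
lemma setIntegral_abel_mul_transform {a : ℝ} {v : ℝ → ℝ} (hα0 : 0 < α) (hα1 : α < 1)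
    (hv : IntegrableOn v (Ioo 0 a)) :
    IntegrableOn (fun s => (a - s) ^ (α - 1) * ∫ u in Ioo 0 s, (s - u) ^ (-α) * v u)
        (Ioo 0 a) ∧
      ∫ s in Ioo 0 a, (a - s) ^ (α - 1) * ∫ u in Ioo 0 s, (s - u) ^ (-α) * v u =
        Real.Gamma (1 - α) * Real.Gamma α * ∫ u in Ioo 0 a, v u := by
  have h := setIntegral_mul_abelTransform (α := α) (a := a) (v := v)
    (Q := fun s => (a - s) ^ (α - 1)) (g := fun _ => Real.Gamma (1 - α) * Real.Gamma α)
    (by fun_prop) (fun s hs => Real.rpow_nonneg (sub_nonneg.2 hs.2.le) _)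
    (fun u hu => integrableOn_abel hα0 hα1 hu.2)
    (fun u hu => setIntegral_abel hα0 hα1 hu.2) hv (hv.const_mul _)
  exact ⟨h.1, h.2.trans (integral_const_mul _ _)⟩

lemma setIntegral_abel_zero {s : ℝ} (hα0 : 0 < α) (hα1 : α < 1) (hs : 0 < s) :
    ∫ u in Ioo 0 s, (s - u) ^ (-α) * u ^ (α - 1) = Real.Gamma (1 - α) * Real.Gamma α := by
  have h := setIntegral_abel (α := 1 - α) (u := 0) (b := s) (by linarith) (by linarith) hs
  rw [sub_sub_cancel, mul_comm (Real.Gamma α)] at h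
  rw [← h]
  refine setIntegral_congr_fun measurableSet_Ioo fun u _ => ?_
  simp only [sub_zero]
  congr 2 <;> ring

lemma integrableOn_abel_zero {s : ℝ} (hα0 : 0 < α) (hα1 : α < 1) (hs : 0 < s) :
    IntegrableOn (fun u => (s - u) ^ (-α) * u ^ (α - 1)) (Ioo 0 s) :=
  integrableOn_of_setIntegral_pos <|
    (setIntegral_abel_zero hα0 hα1 hs).symm ▸ gamma_mul_gamma_pos hα0 hα1

/-- Total mass of the continuation kernel. -/
lemma integral_abelPoisson {a t : ℝ} (hα0 : 0 < α) (hα1 : α < 1) (ha : 0 < a) (hat : a < t) :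
    IntegrableOn (abelPoisson α a t) (Ioo 0 a) ∧
      ∫ s in Ioo 0 a, abelPoisson α a t s = ∫ u in Ioo 0 a, (t - u) ^ (-α) * u ^ (α - 1) := by
  have hC := gamma_mul_gamma_pos hα0 hα1
  have hv : IntegrableOn (fun u : ℝ => u ^ (α - 1)) (Ioo 0 a) :=
    (intervalIntegrable_iff_integrableOn_Ioo_of_le ha.le).1
      (intervalIntegral.intervalIntegrable_rpow' (by linarith))
  obtain ⟨h1, h2⟩ := setIntegral_abelPoisson_mul_transform hα0 hα1 hat hv
  have hcongr : EqOn
      (fun s => abelPoisson α a t s * ∫ u in Ioo 0 s, (s - u) ^ (-α) * u ^ (α - 1))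
      (fun s => abelPoisson α a t s * (Real.Gamma (1 - α) * Real.Gamma α)) (Ioo 0 a) :=
    fun s hs => by simp only [setIntegral_abel_zero hα0 hα1 hs.1]
  constructor
  · have := (integrableOn_congr_fun hcongr measurableSet_Ioo).1 h1
    have := this.mul_const (Real.Gamma (1 - α) * Real.Gamma α)⁻¹
    exact this.congr (ae_of_all _ fun s => mul_inv_cancel_right₀ hC.ne' (abelPoisson α a t s))
  · rw [setIntegral_congr_fun measurableSet_Ioo hcongr, integral_mul_const, mul_comm] at h2
    exact mul_left_cancel₀ hC.ne' h2

lemma integral_abelPoisson_le {a t : ℝ} (hα0 : 0 < α) (hα1 : α < 1) (ha : 0 < a) (hat : a < t) :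
    ∫ s in Ioo 0 a, abelPoisson α a t s ≤ Real.Gamma (1 - α) * Real.Gamma α := by
  rw [(integral_abelPoisson hα0 hα1 ha hat).2, ← setIntegral_abel_zero hα0 hα1 (ha.trans hat)]
  refine setIntegral_mono_set (integrableOn_abel_zero hα0 hα1 (ha.trans hat)) ?_
    (Ioo_subset_Ioo_right hat.le).eventuallyLE
  refine (ae_restrict_iff' measurableSet_Ioo).2 (ae_of_all _ fun u hu => ?_)
  exact mul_nonneg (Real.rpow_nonneg (sub_nonneg.2 hu.2.le) _) (Real.rpow_nonneg hu.1.le _)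

lemma tendsto_integral_abelPoisson {t : ℝ} (hα0 : 0 < α) (hα1 : α < 1) (ht : 0 < t) :
    Tendsto (fun a => ∫ s in Ioo 0 a, abelPoisson α a t s) (𝓝[<] t)
      (𝓝 (Real.Gamma (1 - α) * Real.Gamma α)) := by
  have hii : IntervalIntegrable (fun u => (t - u) ^ (-α) * u ^ (α - 1)) volume 0 t :=
    (intervalIntegrable_iff_integrableOn_Ioo_of_le ht.le).2 (integrableOn_abel_zero hα0 hα1 ht)
  have hc := intervalIntegral.continuousOn_primitive_interval' hii left_mem_uIcc t right_mem_uIcc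
  rw [uIcc_of_le ht.le, ContinuousWithinAt, intervalIntegral.integral_of_le ht.le,
    integral_Ioc_eq_integral_Ioo, setIntegral_abel_zero hα0 hα1 ht] at hc
  have hmem : ∀ᶠ a in 𝓝[<] t, a ∈ Ioo 0 t := Ioo_mem_nhdsLT ht
  have hle : 𝓝[<] t ≤ 𝓝[Icc 0 t] t :=
    nhdsWithin_le_of_mem (mem_of_superset hmem Ioo_subset_Icc_self)
  refine (hc.mono_left hle).congr' ?_
  filter_upwards [hmem] with a ha
  rw [(integral_abelPoisson hα0 hα1 ha.1 ha.2).2, intervalIntegral.integral_of_le ha.1.le,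
    integral_Ioc_eq_integral_Ioo]

end Kernels

/-- The impact Volterra equation after normalization: `y` is the Abel transform of `Λ v`,
and `v = 1 - y₊ ^ β`. -/
structure IsNormalizedSolution (α β Λ T : ℝ) (v y : ℝ → ℝ) : Prop where
  continuousOn : ContinuousOn v (Icc 0 T)
  eq_transform : ∀ s ∈ Icc 0 T, y s = Λ * ∫ u in Ioo 0 s, (s - u) ^ (-α) * v u
  eq_source : ∀ s ∈ Icc 0 T, v s = 1 - (max (y s) 0) ^ β

namespace IsNormalizedSolution

variable {α β Λ T : ℝ} {v y : ℝ → ℝ}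

lemma integrableOn_source (h : IsNormalizedSolution α β Λ T v y) {a b : ℝ} (ha : 0 ≤ a)
    (hb : b ≤ T) : IntegrableOn v (Ioo a b) :=
  (h.continuousOn.mono (Icc_subset_Icc ha hb)).integrableOn_Icc.mono_set Ioo_subset_Icc_self

lemma intervalIntegrable_kernel_mul (h : IsNormalizedSolution α β Λ T v y) (hα1 : α < 1)
    {a b t : ℝ} (ha : 0 ≤ a) (hab : a ≤ b) (hb : b ≤ T) :
    IntervalIntegrable (fun u => (t - u) ^ (-α) * v u) volume a b := by
  refine (intervalIntegrable_sub_rpow (by linarith)).mul_continuousOn ?_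
  rw [uIcc_of_le hab]
  exact h.continuousOn.mono (Icc_subset_Icc ha hb)

lemma integrableOn_kernel_mul (h : IsNormalizedSolution α β Λ T v y) (hα1 : α < 1)
    {a b t : ℝ} (ha : 0 ≤ a) (hab : a ≤ b) (hb : b ≤ T) :
    IntegrableOn (fun u => (t - u) ^ (-α) * v u) (Ioo a b) :=
  (intervalIntegrable_iff_integrableOn_Ioo_of_le hab).1
    (h.intervalIntegrable_kernel_mul hα1 ha hab hb)

lemma integral_abelPoisson_mul (h : IsNormalizedSolution α β Λ T v y) (hα0 : 0 < α)
    (hα1 : α < 1) {a t : ℝ} (hat : a < t) (ht : t ≤ T) :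
    IntegrableOn (fun s => abelPoisson α a t s * y s) (Ioo 0 a) ∧
      ∫ s in Ioo 0 a, abelPoisson α a t s * y s =
        Real.Gamma (1 - α) * Real.Gamma α * (Λ * ∫ u in Ioo 0 a, (t - u) ^ (-α) * v u) := by
  obtain ⟨h1, h2⟩ := setIntegral_abelPoisson_mul_transform hα0 hα1 hat
    (h.integrableOn_source le_rfl (hat.le.trans ht))
  have hcongr : EqOn (fun s => abelPoisson α a t s * y s)
      (fun s => Λ * (abelPoisson α a t s * ∫ u in Ioo 0 s, (s - u) ^ (-α) * v u)) (Ioo 0 a) := by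
    intro s hs
    simp only [h.eq_transform s ⟨hs.1.le, by linarith [hs.2]⟩]
    ring
  refine ⟨(integrableOn_congr_fun hcongr measurableSet_Ioo).2 (h1.const_mul Λ), ?_⟩
  rw [setIntegral_congr_fun measurableSet_Ioo hcongr, integral_const_mul, h2]
  ring

lemma integral_abel_mul (h : IsNormalizedSolution α β Λ T v y) (hα0 : 0 < α)
    (hα1 : α < 1) {t : ℝ} (ht : t ≤ T) :
    IntegrableOn (fun s => (t - s) ^ (α - 1) * y s) (Ioo 0 t) ∧
      ∫ s in Ioo 0 t, (t - s) ^ (α - 1) * y s =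
        Real.Gamma (1 - α) * Real.Gamma α * (Λ * ∫ u in Ioo 0 t, v u) := by
  obtain ⟨h1, h2⟩ := setIntegral_abel_mul_transform hα0 hα1 (h.integrableOn_source le_rfl ht)
  have hcongr : EqOn (fun s => (t - s) ^ (α - 1) * y s)
      (fun s => Λ * ((t - s) ^ (α - 1) * ∫ u in Ioo 0 s, (s - u) ^ (-α) * v u)) (Ioo 0 t) := by
    intro s hs
    simp only [h.eq_transform s ⟨hs.1.le, by linarith [hs.2]⟩]
    ring
  refine ⟨(integrableOn_congr_fun hcongr measurableSet_Ioo).2 (h1.const_mul Λ), ?_⟩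
  rw [setIntegral_congr_fun measurableSet_Ioo hcongr, integral_const_mul, h2]
  ring

lemma transform_split (h : IsNormalizedSolution α β Λ T v y) (hα1 : α < 1)
    {a t : ℝ} (ha : 0 ≤ a) (hat : a ≤ t) (ht : t ≤ T) :
    y t = Λ * (∫ u in Ioo 0 a, (t - u) ^ (-α) * v u) +
      Λ * ∫ u in Ioo a t, (t - u) ^ (-α) * v u := by
  rw [h.eq_transform t ⟨ha.trans hat, ht⟩, ← mul_add]
  simp only [← integral_Ioc_eq_integral_Ioo]
  rw [← intervalIntegral.integral_of_le ha, ← intervalIntegral.integral_of_le hat,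
    ← intervalIntegral.integral_of_le (ha.trans hat),
    intervalIntegral.integral_add_adjacent_intervals
      (h.intervalIntegrable_kernel_mul hα1 le_rfl ha (hat.trans ht))
      (h.intervalIntegrable_kernel_mul hα1 ha hat ht)]

/-- Maximum principle: the source never becomes negative. -/
lemma source_nonneg (h : IsNormalizedSolution α β Λ T v y) (hα0 : 0 < α) (hα1 : α < 1)
    (hβ : 0 < β) (hΛ : 0 < Λ) {s : ℝ} (hs : s ∈ Icc 0 T) : 0 ≤ v s := by
  have hC := gamma_mul_gamma_pos hα0 hα1
  obtain ⟨t, ht, hmin⟩ := isCompact_Icc.exists_isMinOn ⟨s, hs⟩ h.continuousOn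
  refine le_trans ?_ (hmin hs)
  by_contra! hneg
  have h0 : v 0 = 1 := by
    rw [h.eq_source 0 ⟨le_rfl, hs.1.trans hs.2⟩, h.eq_transform 0 ⟨le_rfl, hs.1.trans hs.2⟩]
    simp [Real.zero_rpow hβ.ne']
  have ht0 : 0 < t := lt_of_le_of_ne ht.1 (by rintro rfl; linarith)
  have hyt : 1 < max (y t) 0 := by
    have := h.eq_source t ht
    by_contra! hle
    have := Real.rpow_le_one (le_max_right (y t) 0) hle hβ.le
    linarith
  have hyt' : max (y t) 0 = y t := max_eq_left_of_lt (by
    by_contra! hle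
    rw [max_eq_right hle] at hyt
    linarith)
  have hymax : ∀ s ∈ Icc 0 T, y s ≤ y t := by
    intro s hs
    have h1 : v t ≤ v s := hmin hs
    rw [h.eq_source t ht, h.eq_source s hs] at h1
    have h2 := (Real.rpow_le_rpow_iff (le_max_right (y s) 0) (le_max_right (y t) 0) hβ).1
      (by linarith)
    rw [hyt'] at h2
    exact (le_max_left _ _).trans h2
  obtain ⟨a, ⟨ha0, hat⟩, hva⟩ : ∃ a ∈ Ioo 0 t, ∀ u ∈ Ioo a t, v u < 0 := by
    have hev : ∀ᶠ u in 𝓝[Icc 0 T] t, v u < 0 := (h.continuousOn t ht).eventually_lt_const hneg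
    have hle : 𝓝[<] t ≤ 𝓝[Icc 0 T] t := nhdsWithin_le_of_mem
      (mem_of_superset (Ioo_mem_nhdsLT ht0) fun x hx => ⟨hx.1.le, hx.2.le.trans ht.2⟩)
    obtain ⟨l, hl, hl'⟩ := (mem_nhdsLT_iff_exists_Ioo_subset' ht0).1 (hle hev)
    refine ⟨max l (t / 2), ⟨by positivity, max_lt hl (by linarith)⟩, fun u hu => hl' ⟨?_, hu.2⟩⟩
    exact (le_max_left _ _).trans_lt hu.1
  obtain ⟨hPi, hP⟩ := h.integral_abelPoisson_mul hα0 hα1 hat ht.2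
  obtain ⟨hPi', -⟩ := integral_abelPoisson hα0 hα1 ha0 hat
  have hpast : Λ * (∫ u in Ioo 0 a, (t - u) ^ (-α) * v u) ≤ y t := by
    have h1 : ∫ s in Ioo 0 a, abelPoisson α a t s * y s ≤
        ∫ s in Ioo 0 a, abelPoisson α a t s * y t :=
      setIntegral_mono_on hPi (hPi'.mul_const _) measurableSet_Ioo fun s hs =>
        mul_le_mul_of_nonneg_left (hymax s ⟨hs.1.le, by linarith [hs.2, ht.2]⟩)
          (abelPoisson_nonneg hat.le hs.2.le)
    rw [hP, integral_mul_const] at h1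
    have h2 := mul_le_mul_of_nonneg_right (integral_abelPoisson_le hα0 hα1 ha0 hat)
      (show 0 ≤ y t by linarith [hyt'])
    exact le_of_mul_le_mul_left (h1.trans h2) hC
  have hrecent : ∫ u in Ioo a t, (t - u) ^ (-α) * v u < 0 := by
    have hii := (h.intervalIntegrable_kernel_mul (t := t) hα1 ha0.le hat.le ht.2).neg
    have := intervalIntegral.intervalIntegral_pos_of_pos_on hii (fun u hu => by
      have := mul_neg_of_pos_of_neg (Real.rpow_pos_of_pos (sub_pos.2 hu.2) (-α)) (hva u hu)
      simpa using this) hat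
    rw [intervalIntegral.integral_of_le hat.le, integral_Ioc_eq_integral_Ioo] at this
    simp only [Pi.neg_apply, integral_neg] at this
    linarith
  have := h.transform_split hα1 ha0.le hat.le ht.2
  nlinarith [mul_neg_of_pos_of_neg hΛ hrecent]

lemma nonneg (h : IsNormalizedSolution α β Λ T v y) (hα0 : 0 < α) (hα1 : α < 1)
    (hβ : 0 < β) (hΛ : 0 < Λ) {s : ℝ} (hs : s ∈ Icc 0 T) : 0 ≤ y s := by
  rw [h.eq_transform s hs]
  exact mul_nonneg hΛ.le (setIntegral_nonneg measurableSet_Ioo fun u hu =>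
    mul_nonneg (Real.rpow_nonneg (sub_nonneg.2 hu.2.le) _)
      (h.source_nonneg hα0 hα1 hβ hΛ ⟨hu.1.le, hu.2.le.trans hs.2⟩))

lemma le_one (h : IsNormalizedSolution α β Λ T v y) (hα0 : 0 < α) (hα1 : α < 1)
    (hβ : 0 < β) (hΛ : 0 < Λ) {s : ℝ} (hs : s ∈ Icc 0 T) : y s ≤ 1 := by
  have h1 := h.source_nonneg hα0 hα1 hβ hΛ hs
  rw [h.eq_source s hs] at h1
  by_contra! hlt
  have := Real.one_lt_rpow (lt_max_of_lt_left hlt : 1 < max (y s) 0) hβ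
  linarith

lemma one_sub_le_source (h : IsNormalizedSolution α β Λ T v y) (hα0 : 0 < α) (hα1 : α < 1)
    (hβ : 1 ≤ β) (hΛ : 0 < Λ) {s : ℝ} (hs : s ∈ Icc 0 T) : 1 - y s ≤ v s := by
  have h0 := h.nonneg hα0 hα1 (by linarith) hΛ hs
  have h1 := h.le_one hα0 hα1 (by linarith) hΛ hs
  have := Real.rpow_le_rpow_of_exponent_ge' h0 h1 zero_le_one hβ
  rw [Real.rpow_one] at this
  rw [h.eq_source s hs, max_eq_left h0]
  linarith

lemma integral_source_le (h : IsNormalizedSolution α β Λ T v y) (hα0 : 0 < α) (hα1 : α < 1)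
    (hβ : 0 < β) (hΛ : 0 < Λ) {t : ℝ} (ht0 : 0 < t) (ht : t ≤ T) :
    ∫ u in Ioo 0 t, v u ≤ t ^ α / Λ := by
  have h1 := h.le_one hα0 hα1 hβ hΛ ⟨ht0.le, ht⟩
  rw [h.eq_transform t ⟨ht0.le, ht⟩] at h1
  have h2 : ∫ u in Ioo 0 t, t ^ (-α) * v u ≤ ∫ u in Ioo 0 t, (t - u) ^ (-α) * v u :=
    setIntegral_mono_on ((h.integrableOn_source le_rfl ht).const_mul _)
      (h.integrableOn_kernel_mul hα1 le_rfl ht0.le ht) measurableSet_Ioo fun u hu =>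
        mul_le_mul_of_nonneg_right
          (Real.rpow_le_rpow_of_nonpos (sub_pos.2 hu.2) (by linarith [hu.1]) (by linarith))
          (h.source_nonneg hα0 hα1 hβ hΛ ⟨hu.1.le, hu.2.le.trans ht⟩)
  rw [integral_const_mul, Real.rpow_neg ht0.le] at h2
  have h3 := (mul_le_mul_of_nonneg_left h2 hΛ.le).trans h1
  have hp : 0 < t ^ α := Real.rpow_pos_of_pos ht0 α
  rw [le_div_iff₀ hΛ]
  rw [show Λ * ((t ^ α)⁻¹ * ∫ u in Ioo 0 t, v u) = ((∫ u in Ioo 0 t, v u) * Λ) / t ^ α by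
    field_simp, div_le_one hp] at h3
  exact h3

lemma integral_abel_defect_le (h : IsNormalizedSolution α β Λ T v y) (hα0 : 0 < α)
    (hα1 : α < 1) (hβ : 1 ≤ β) (hΛ : 0 < Λ) {t : ℝ} (ht0 : 0 < t) (ht : t ≤ T) :
    ∫ s in Ioo 0 t, (t - s) ^ (α - 1) * (1 - y s) ≤
      t ^ α * Λ ^ (-α) + t ^ (α / 2) / (α / 2) * Λ ^ (-(α / 2)) := by
  have hδ : 0 < Λ⁻¹ := inv_pos.2 hΛ
  have hi : IntegrableOn (fun s => (t - s) ^ (α - 1) * (1 - y s)) (Ioo 0 t) := by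
    have := (integrableOn_sub_rpow (ρ := α - 1) (t := t) (by linarith) ht0.le).sub
      (h.integral_abel_mul hα0 hα1 ht).1
    refine this.congr (ae_of_all _ fun s => ?_)
    simp only [Pi.sub_apply]
    ring
  have hi1 : IntegrableOn (fun s => Λ⁻¹ ^ (α - 1) * v s) (Ioo 0 t) :=
    (h.integrableOn_source le_rfl ht).const_mul _
  have hi2 : IntegrableOn (fun s => Λ⁻¹ ^ (α / 2) * (t - s) ^ (α / 2 - 1)) (Ioo 0 t) :=
    (integrableOn_sub_rpow (by linarith) ht0.le).const_mul _
  have hle : ∫ s in Ioo 0 t, (t - s) ^ (α - 1) * (1 - y s) ≤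
      ∫ s in Ioo 0 t, (Λ⁻¹ ^ (α - 1) * v s + Λ⁻¹ ^ (α / 2) * (t - s) ^ (α / 2 - 1)) := by
    refine setIntegral_mono_on hi (hi1.add hi2) measurableSet_Ioo fun s hs => ?_
    have hsT : s ∈ Icc 0 T := ⟨hs.1.le, hs.2.le.trans ht⟩
    have hx : 0 < t - s := sub_pos.2 hs.2
    have hv0 := h.source_nonneg hα0 hα1 (by linarith) hΛ hsT
    have hy0 := h.nonneg hα0 hα1 (by linarith) hΛ hsT
    have hy1 := h.le_one hα0 hα1 (by linarith) hΛ hsT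
    have hyv := h.one_sub_le_source hα0 hα1 hβ hΛ hsT
    have p1 : 0 < Λ⁻¹ ^ (α - 1) := Real.rpow_pos_of_pos hδ _
    have p2 : 0 < Λ⁻¹ ^ (α / 2) := Real.rpow_pos_of_pos hδ _
    have p3 : 0 < (t - s) ^ (α / 2 - 1) := Real.rpow_pos_of_pos hx _
    have p4 : 0 < (t - s) ^ (α - 1) := Real.rpow_pos_of_pos hx _
    rcases le_total Λ⁻¹ (t - s) with hc | hc
    · have h1 := Real.rpow_le_rpow_of_nonpos hδ hc (show α - 1 ≤ 0 by linarith)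
      have := mul_le_mul h1 hyv (by linarith) p1.le
      have := mul_pos p2 p3
      linarith
    · have h1 : (t - s) ^ (α - 1) = (t - s) ^ (α / 2) * (t - s) ^ (α / 2 - 1) := by
        rw [← Real.rpow_add hx]
        congr 1
        ring
      have h2 := mul_le_mul_of_nonneg_right
        (Real.rpow_le_rpow hx.le hc (show 0 ≤ α / 2 by linarith)) p3.le
      rw [← h1] at h2
      have h3 := mul_nonneg p1.le hv0
      have h4 := mul_le_mul_of_nonneg_left (show 1 - y s ≤ 1 by linarith) p4.le
      linarith
  rw [integral_add hi1 hi2, integral_const_mul, integral_const_mul,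
    setIntegral_sub_rpow (by linarith) ht0.le] at hle
  have h1 := mul_le_mul_of_nonneg_left
    (h.integral_source_le hα0 hα1 (by linarith) hΛ ht0 ht) (Real.rpow_pos_of_pos hδ (α - 1)).le
  have e1 : Λ⁻¹ ^ (α - 1) * (t ^ α / Λ) = t ^ α * Λ ^ (-α) := by
    rw [Real.inv_rpow hΛ.le, Real.rpow_sub_one hΛ.ne', Real.rpow_neg hΛ.le]
    have := Real.rpow_pos_of_pos hΛ α
    field_simp
  have e2 : Λ⁻¹ ^ (α / 2) = Λ ^ (-(α / 2)) := by
    rw [Real.inv_rpow hΛ.le, Real.rpow_neg hΛ.le]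
  rw [e1] at h1
  rw [e2] at hle
  linarith

lemma integral_abel_defect_nonneg (h : IsNormalizedSolution α β Λ T v y) (hα0 : 0 < α)
    (hα1 : α < 1) (hβ : 0 < β) (hΛ : 0 < Λ) {t : ℝ} (ht : t ≤ T) :
    0 ≤ ∫ s in Ioo 0 t, (t - s) ^ (α - 1) * (1 - y s) :=
  setIntegral_nonneg measurableSet_Ioo fun _ hs =>
    mul_nonneg (Real.rpow_nonneg (sub_nonneg.2 hs.2.le) _)
      (sub_nonneg.2 (h.le_one hα0 hα1 hβ hΛ ⟨hs.1.le, hs.2.le.trans ht⟩))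

lemma integral_abel_defect_eq (h : IsNormalizedSolution α β Λ T v y) (hα0 : 0 < α)
    (hα1 : α < 1) {t : ℝ} (ht0 : 0 ≤ t) (ht : t ≤ T) :
    ∫ s in Ioo 0 t, (t - s) ^ (α - 1) * (1 - y s) =
      t ^ α / α - Real.Gamma (1 - α) * Real.Gamma α * (Λ * ∫ u in Ioo 0 t, v u) := by
  obtain ⟨h1, h2⟩ := h.integral_abel_mul hα0 hα1 ht
  rw [← h2, ← setIntegral_sub_rpow hα0 ht0,
    ← integral_sub (integrableOn_sub_rpow (by linarith) ht0) h1]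
  simp only [mul_sub, mul_one]

lemma le_transform (h : IsNormalizedSolution α β Λ T v y) (hα0 : 0 < α) (hα1 : α < 1)
    (hβ : 0 < β) (hΛ : 0 < Λ) {a t : ℝ} (ha : 0 < a) (hat : a < t) (ht : t ≤ T) :
    ∫ s in Ioo 0 a, abelPoisson α a t s ≤ Real.Gamma (1 - α) * Real.Gamma α * y t +
      (t - a) ^ (-α) * ∫ s in Ioo 0 a, (a - s) ^ (α - 1) * (1 - y s) := by
  have hC := gamma_mul_gamma_pos hα0 hα1
  have hta : 0 < t - a := sub_pos.2 hat
  have haT : a ≤ T := hat.le.trans ht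
  obtain ⟨hPi, hP⟩ := h.integral_abelPoisson_mul hα0 hα1 hat ht
  have hi : IntegrableOn (fun s => (a - s) ^ (α - 1) * (1 - y s)) (Ioo 0 a) := by
    have := (integrableOn_sub_rpow (ρ := α - 1) (t := a) (by linarith) ha.le).sub
      (h.integral_abel_mul hα0 hα1 haT).1
    refine this.congr (ae_of_all _ fun s => ?_)
    simp only [Pi.sub_apply]
    ring
  have h1 : ∫ s in Ioo 0 a, abelPoisson α a t s ≤ ∫ s in Ioo 0 a,
      (abelPoisson α a t s * y s + (t - a) ^ (-α) * ((a - s) ^ (α - 1) * (1 - y s))) := by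
    refine setIntegral_mono_on (integral_abelPoisson hα0 hα1 ha hat).1
      (hPi.add (hi.const_mul _)) measurableSet_Ioo fun s hs => ?_
    have hy1 := h.le_one hα0 hα1 hβ hΛ ⟨hs.1.le, hs.2.le.trans haT⟩
    have hker : abelPoisson α a t s ≤ (t - a) ^ (-α) * (a - s) ^ (α - 1) := by
      have e : (t - a) ^ (1 - α) = (t - a) ^ (-α) * (t - a) := by
        rw [sub_eq_neg_add 1 α, Real.rpow_add_one hta.ne']
      have p1 : 0 ≤ (t - a) ^ (-α) * (a - s) ^ (α - 1) :=
        mul_nonneg (Real.rpow_nonneg hta.le _) (Real.rpow_nonneg (sub_nonneg.2 hs.2.le) _)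
      have hts : 0 < t - s := by linarith [hs.2]
      have e' : abelPoisson α a t s =
          (t - a) ^ (-α) * (a - s) ^ (α - 1) * ((t - a) / (t - s)) := by
        rw [abelPoisson, e]
        ring
      rw [e']
      exact mul_le_of_le_one_right p1 ((div_le_one hts).2 (by linarith [hs.2]))
    nlinarith [mul_le_mul_of_nonneg_right hker (sub_nonneg.2 hy1)]
  rw [integral_add hPi (hi.const_mul _), integral_const_mul, hP] at h1
  have h2 : Λ * (∫ u in Ioo 0 a, (t - u) ^ (-α) * v u) ≤ y t := by
    rw [h.transform_split hα1 ha.le hat.le ht]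
    refine le_add_of_nonneg_right (mul_nonneg hΛ.le (setIntegral_nonneg measurableSet_Ioo
      fun u hu => mul_nonneg (Real.rpow_nonneg (sub_nonneg.2 hu.2.le) _)
        (h.source_nonneg hα0 hα1 hβ hΛ ⟨(ha.trans hu.1).le, hu.2.le.trans ht⟩)))
  linarith [mul_le_mul_of_nonneg_left h2 hC.le]

section Limit

variable {ι : Type*} {l : Filter ι} {Λ : ι → ℝ} {v y : ι → ℝ → ℝ}

lemma tendsto_integral_abel_defect (hα0 : 0 < α) (hα1 : α < 1) (hβ : 1 ≤ β)
    (hΛ : Tendsto Λ l atTop)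
    (h : ∀ᶠ i in l, IsNormalizedSolution α β (Λ i) T (v i) (y i))
    {t : ℝ} (ht0 : 0 < t) (ht : t ≤ T) :
    Tendsto (fun i => ∫ s in Ioo 0 t, (t - s) ^ (α - 1) * (1 - y i s)) l (𝓝 0) := by
  have h1 := ((tendsto_rpow_neg_atTop hα0).comp hΛ).const_mul (t ^ α)
  have h2 := ((tendsto_rpow_neg_atTop (half_pos hα0)).comp hΛ).const_mul (t ^ (α / 2) / (α / 2))
  have h3 := h1.add h2
  simp only [mul_zero, add_zero] at h3
  refine tendsto_of_tendsto_of_tendsto_of_le_of_le' tendsto_const_nhds h3 ?_ ?_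
  · filter_upwards [h, hΛ.eventually_gt_atTop 0] with i hi hΛi
    exact hi.integral_abel_defect_nonneg hα0 hα1 (by linarith) hΛi ht
  · filter_upwards [h, hΛ.eventually_gt_atTop 0] with i hi hΛi
    exact hi.integral_abel_defect_le hα0 hα1 hβ hΛi ht0 ht

lemma tendsto_transform (hα0 : 0 < α) (hα1 : α < 1) (hβ : 1 ≤ β)
    (hΛ : Tendsto Λ l atTop)
    (h : ∀ᶠ i in l, IsNormalizedSolution α β (Λ i) T (v i) (y i))
    {t : ℝ} (ht0 : 0 < t) (ht : t ≤ T) :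
    Tendsto (fun i => y i t) l (𝓝 1) := by
  have hC := gamma_mul_gamma_pos hα0 hα1
  refine tendsto_order.2 ⟨fun b hb => ?_, fun b hb => ?_⟩
  · have hlt : Real.Gamma (1 - α) * Real.Gamma α * b < Real.Gamma (1 - α) * Real.Gamma α :=
      mul_lt_of_lt_one_right hC hb
    obtain ⟨a, hP, ha⟩ := (((tendsto_integral_abelPoisson hα0 hα1 ht0).eventually_const_lt
      hlt).and (Ioo_mem_nhdsLT ht0)).exists
    have hD := (tendsto_integral_abel_defect hα0 hα1 hβ hΛ h ha.1 (ha.2.le.trans ht)).const_mul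
      ((t - a) ^ (-α))
    rw [mul_zero] at hD
    filter_upwards [h, hΛ.eventually_gt_atTop 0, hD.eventually_lt_const (sub_pos.2 hP)]
      with i hi hΛi hDi
    have := hi.le_transform hα0 hα1 (by linarith) hΛi ha.1 ha.2 ht
    exact lt_of_mul_lt_mul_left (by linarith) hC.le
  · filter_upwards [h, hΛ.eventually_gt_atTop 0] with i hi hΛi
    exact (hi.le_one hα0 hα1 (by linarith) hΛi ⟨ht0.le, ht⟩).trans_lt hb

end Limit

end IsNormalizedSolution

/-- Large-participation asymptotics of the macroscopic market impact with
power-law nonlinearity `H(x) = c x₊^β` and execution profile `f = 1` on `[0,1]`: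
for every fixed `0 < t < 1`,
`MI(γ, t) ∼ γ^{1/β} c^{−1/β} (1 + λ t^α / (α Γ(1−α) Γ(α)))` as `γ → ∞`. -/
theorem stmt_15
    (α lam κ β c : ℝ) (hα0 : 0 < α) (hα1 : α < 1) (hlam : 0 < lam)
    (hκ : 0 < κ) (hβ : 1 < β) (hc : 0 < c)
    (H : ℝ → ℝ) (hH : ∀ x : ℝ, H x = if 0 ≤ x then c * x ^ β else 0)
    (f : ℝ → ℝ) (hf : ∀ s : ℝ, f s = if s ≤ 1 then 1 else 0)
    (r : ℝ → ℝ → ℝ)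
    (hr_cont : ∀ γ, 0 < γ → ContinuousOn (r γ) (Ici 0))
    (hr_eq : ∀ γ, 0 < γ → ∀ t, 0 ≤ t →
      r γ t = H (κ * ∫ s in (0:ℝ)..t, lam⁻¹ * (t - s) ^ (-α) * (γ * f s - r γ s))) :
    ∀ t, 0 < t → t < 1 →
      Tendsto
        (fun γ : ℝ =>
          (κ * ∫ s in (0:ℝ)..t, (1 + lam⁻¹ * (t - s) ^ (-α)) * (γ * f s - r γ s)) /
            (γ ^ (1 / β) * c ^ (-(1 / β)) *
              (1 + lam / (α * Real.Gamma (1 - α) * Real.Gamma α) * t ^ α)))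
        atTop (𝓝 1) := by
  intro t ht0 ht1
  have hβ0 : 0 < β := by linarith
  have hC := gamma_mul_gamma_pos hα0 hα1
  set X : ℝ → ℝ := fun γ => γ ^ (1 / β) * c ^ (-(1 / β)) with hX
  set Λ : ℝ → ℝ := fun γ => κ * lam⁻¹ * γ / X γ with hΛdef
  set v : ℝ → ℝ → ℝ := fun γ u => 1 - r γ u / γ with hv
  set x : ℝ → ℝ → ℝ := fun γ s =>
    κ * ∫ u in (0:ℝ)..s, lam⁻¹ * (s - u) ^ (-α) * (γ * f u - r γ u) with hx
  set y : ℝ → ℝ → ℝ := fun γ s => x γ s / X γ with hy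
  have hXpos : ∀ γ, 0 < γ → 0 < X γ := fun γ hγ =>
    mul_pos (Real.rpow_pos_of_pos hγ _) (Real.rpow_pos_of_pos hc _)
  have hXβ : ∀ γ, 0 < γ → X γ ^ β = γ / c := by
    intro γ hγ
    simp only [hX]
    rw [Real.mul_rpow (Real.rpow_nonneg hγ.le _) (Real.rpow_nonneg hc.le _),
      ← Real.rpow_mul hγ.le, ← Real.rpow_mul hc.le, neg_mul, one_div_mul_cancel hβ0.ne',
      Real.rpow_one, Real.rpow_neg_one, div_eq_mul_inv]
  have hsource : ∀ γ, 0 < γ → ∀ u ∈ Icc 0 t, γ * f u - r γ u = γ * v γ u := by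
    intro γ hγ u hu
    simp only [hv]
    rw [hf, if_pos (hu.2.trans ht1.le)]
    field_simp
  have hHmax : ∀ z, H z = c * (max z 0) ^ β := by
    intro z
    rw [hH]
    split_ifs with hz
    · rw [max_eq_left hz]
    · rw [max_eq_right (not_le.1 hz).le, Real.zero_rpow hβ0.ne', mul_zero]
  have hsol : ∀ γ, 0 < γ → IsNormalizedSolution α β (Λ γ) t (v γ) (y γ) := by
    intro γ hγ
    have hXγ := hXpos γ hγ
    refine ⟨?_, fun s hs => ?_, fun s hs => ?_⟩
    · exact continuousOn_const.sub
        (((hr_cont γ hγ).mono Icc_subset_Ici_self).div_const γ)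
    · simp only [hy, hx, hΛdef]
      rw [intervalIntegral.integral_of_le hs.1, integral_Ioc_eq_integral_Ioo]
      have : ∫ u in Ioo 0 s, lam⁻¹ * (s - u) ^ (-α) * (γ * f u - r γ u) =
          lam⁻¹ * γ * ∫ u in Ioo 0 s, (s - u) ^ (-α) * v γ u := by
        rw [← integral_const_mul]
        refine setIntegral_congr_fun measurableSet_Ioo fun u hu => ?_
        rw [hsource γ hγ u ⟨hu.1.le, hu.2.le.trans hs.2⟩]
        ring
      rw [this]
      ring
    · have hr : r γ s = c * (max (x γ s) 0) ^ β := by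
        rw [← hHmax]
        exact hr_eq γ hγ s hs.1
      have hmax : max (y γ s) 0 = max (x γ s) 0 / X γ := by
        rw [← max_div_div_right hXγ.le, zero_div]
      rw [hmax, Real.div_rpow (le_max_right _ _) hXγ.le, hXβ γ hγ]
      simp only [hv]
      rw [hr]
      field_simp
  have hΛ : Tendsto Λ atTop atTop := by
    have h1 : Tendsto (fun γ : ℝ => κ * lam⁻¹ * c ^ (1 / β) * γ ^ (1 - 1 / β)) atTop atTop := by
      refine (tendsto_rpow_atTop ?_).const_mul_atTop (by positivity)
      rw [sub_pos, div_lt_one hβ0]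
      exact hβ
    refine h1.congr' ?_
    filter_upwards [eventually_gt_atTop 0] with γ hγ
    simp only [hΛdef, hX]
    rw [Real.rpow_sub hγ, Real.rpow_one, Real.rpow_neg hc.le]
    have p1 := Real.rpow_pos_of_pos hγ (1 / β)
    have p2 := Real.rpow_pos_of_pos hc (1 / β)
    field_simp
  have hev : ∀ᶠ γ in atTop, IsNormalizedSolution α β (Λ γ) t (v γ) (y γ) := by
    filter_upwards [eventually_gt_atTop 0] with γ hγ using hsol γ hγ
  have hlimD := IsNormalizedSolution.tendsto_integral_abel_defect hα0 hα1 hβ.le hΛ hev ht0 le_rfl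
  have hlimy := IsNormalizedSolution.tendsto_transform hα0 hα1 hβ.le hΛ hev ht0 le_rfl
  set L : ℝ := 1 + lam / (α * Real.Gamma (1 - α) * Real.Gamma α) * t ^ α with hL
  have hLpos : 0 < L := by
    have := Real.Gamma_pos_of_pos hα0
    have := Real.Gamma_pos_of_pos (sub_pos.2 hα1)
    positivity
  have hlim := (hlimy.add ((hlimD.const_sub (t ^ α / α)).const_mul
    (lam / (Real.Gamma (1 - α) * Real.Gamma α)))).div_const L
  have hone : (1 + lam / (Real.Gamma (1 - α) * Real.Gamma α) * (t ^ α / α - 0)) / L = 1 := by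
    rw [div_eq_one_iff_eq hLpos.ne', hL, sub_zero, mul_assoc]
    congr 1
    field_simp
  rw [hone] at hlim
  refine hlim.congr' ?_
  filter_upwards [eventually_gt_atTop 0] with γ hγ
  have hXγ := hXpos γ hγ
  have hs := hsol γ hγ
  rw [hs.integral_abel_defect_eq hα0 hα1 ht0.le le_rfl]
  have hMI : κ * ∫ s in (0:ℝ)..t, (1 + lam⁻¹ * (t - s) ^ (-α)) * (γ * f s - r γ s) =
      κ * γ * (∫ u in Ioo 0 t, v γ u) + X γ * y γ t := by
    rw [hs.eq_transform t ⟨ht0.le, le_rfl⟩, intervalIntegral.integral_of_le ht0.le,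
      integral_Ioc_eq_integral_Ioo]
    have : ∫ s in Ioo 0 t, (1 + lam⁻¹ * (t - s) ^ (-α)) * (γ * f s - r γ s) =
        ∫ s in Ioo 0 t, (γ * v γ s + γ * lam⁻¹ * ((t - s) ^ (-α) * v γ s)) := by
      refine setIntegral_congr_fun measurableSet_Ioo fun u hu => ?_
      rw [hsource γ hγ u ⟨hu.1.le, hu.2.le⟩]
      ring
    rw [this, integral_add ((hs.integrableOn_source le_rfl le_rfl).const_mul _)
      ((hs.integrableOn_kernel_mul hα1 le_rfl ht0.le le_rfl).const_mul _),
      integral_const_mul, integral_const_mul]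
    simp only [hΛdef]
    field_simp
  rw [hMI]
  have hκγ : κ * γ = Λ γ * lam * X γ := by
    simp only [hΛdef]
    field_simp
  rw [hκγ, sub_sub_cancel, div_mul_eq_mul_div, mul_div_assoc, mul_div_cancel_left₀ _ hC.ne',
    show Λ γ * lam * X γ * (∫ u in Ioo 0 t, v γ u) + X γ * y γ t =
      X γ * (y γ t + lam * (Λ γ * ∫ u in Ioo 0 t, v γ u)) by ring]
  exact (mul_div_mul_left _ _ hXγ.ne').symm
end

section
/- Let 0 < α < 1, λ > 0 and γ > 0. Let H : ℝ → ℝ be continuous, convex, nondecreasing, with H(x) = 0 for x ≤ 0, differentiable and strictly increasing on (0,∞), and let δ > 0 satisfy H(δ) = γ. Let r* : [0,∞) → ℝ be the continuous solution of r*(t) = H(∫₀ᵗ λ⁻¹ (t−s)^{−α} (γ − r*(s)) ds). Then t^{1−α} (γ − r*(t)) → λ δ / (Γ(1−α) Γ(α)) as t → ∞, where Γ is the Gamma function. -/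
open MeasureTheory Set Filter Topology

theorem intervalIntegrable_sub_rpow_mul {p : ℝ} (hp : -1 < p) (c a b : ℝ) {w : ℝ → ℝ}
    (hw : Continuous w) :
    IntervalIntegrable (fun s => (c - s) ^ p * w s) volume a b := by
  have h : IntervalIntegrable (fun s => (c - s) ^ p) volume a b := by
    simpa using (intervalIntegral.intervalIntegrable_rpow' (a := c - a) (b := c - b) hp).comp_sub_left c
  exact h.mul_continuousOn hw.continuousOn

theorem integral_sub_rpow {p : ℝ} (hp : -1 < p) (a b : ℝ) :
    ∫ s in a..b, (b - s) ^ p = (b - a) ^ (p + 1) / (p + 1) := by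
  rw [intervalIntegral.integral_comp_sub_left (fun x => x ^ p) b, sub_self,
    integral_rpow (Or.inl hp), Real.zero_rpow (by linarith), sub_zero]

theorem abelTransform_eq_scaled (p : ℝ) (w : ℝ → ℝ) {t : ℝ} (ht : 0 < t) :
    ∫ s in (0:ℝ)..t, (t - s) ^ p * w s =
      t ^ (p + 1) * ∫ x in (0:ℝ)..1, x ^ p * w (t * (1 - x)) := by
  have h1 := intervalIntegral.integral_comp_sub_left (a := 0) (b := t)
    (fun x => x ^ p * w (t - x)) t
  simp only [sub_sub_cancel, sub_self, sub_zero] at h1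
  rw [h1]
  have h2 := intervalIntegral.mul_integral_comp_mul_left (a := (0:ℝ)) (b := 1)
    (f := fun x : ℝ => (x ^ p * w (t - x) : ℝ)) t
  simp only [mul_zero, mul_one] at h2
  rw [← h2, Real.rpow_add_one ht.ne', mul_comm (t ^ p) t, mul_assoc,
    ← intervalIntegral.integral_const_mul]
  rw [← intervalIntegral.integral_const_mul, ← intervalIntegral.integral_const_mul]
  refine intervalIntegral.integral_congr fun x hx => ?_
  rw [uIcc_of_le zero_le_one] at hx
  simp only [Real.mul_rpow ht.le hx.1]
  ring_nf

theorem continuousOn_abelTransform {p : ℝ} (hp : -1 < p) {w : ℝ → ℝ} (hw : Continuous w) :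
    ContinuousOn (fun t => ∫ s in (0:ℝ)..t, (t - s) ^ p * w s) (Ici 0) := by
  have hc : Continuous fun t => ∫ x in (0:ℝ)..1, x ^ p * w (t * (1 - x)) := by
    rw [continuous_iff_continuousAt]
    intro t₀
    obtain ⟨C, hC⟩ := (isCompact_Icc (a := -(|t₀| + 1)) (b := |t₀| + 1)).exists_bound_of_continuousOn
      hw.continuousOn
    refine intervalIntegral.continuousAt_of_dominated_interval (bound := fun x => x ^ p * C)
      ?_ ?_ ?_ ?_
    · filter_upwards with t
      have : Measurable fun x : ℝ => x ^ p * w (t * (1 - x)) :=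
        (measurable_id.pow_const p).mul (by fun_prop : Continuous fun x => w (t * (1 - x))).measurable
      exact this.aestronglyMeasurable
    · filter_upwards [Metric.ball_mem_nhds t₀ one_pos] with t ht
      refine ae_of_all _ fun x hx => ?_
      rw [uIoc_of_le zero_le_one] at hx
      rw [norm_mul, Real.norm_of_nonneg (Real.rpow_nonneg hx.1.le p)]
      refine mul_le_mul_of_nonneg_left (hC _ ?_) (Real.rpow_nonneg hx.1.le p)
      rw [mem_Icc, ← abs_le, abs_mul]
      have h1 : |t| ≤ |t₀| + 1 := by
        have : |t - t₀| < 1 := by simpa [Real.dist_eq] using ht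
        have := abs_sub_abs_le_abs_sub t t₀
        linarith
      have h2 : |1 - x| ≤ 1 := abs_le.2 ⟨by linarith [hx.2], by linarith [hx.1]⟩
      exact (mul_le_mul h1 h2 (abs_nonneg _) (by positivity)).trans_eq (mul_one _)
    · exact (intervalIntegral.intervalIntegrable_rpow' hp).mul_const C
    · refine ae_of_all _ fun x _ => ?_
      fun_prop
  have h2 : Continuous fun t : ℝ => t ^ (p + 1) := Real.continuous_rpow_const (by linarith)
  refine (h2.mul hc).continuousOn.congr fun t (ht : 0 ≤ t) => ?_
  rcases ht.eq_or_lt with rfl | ht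
  · simp [Real.zero_rpow (by linarith : p + 1 ≠ 0)]
  · exact abelTransform_eq_scaled p w ht

/-- Positivity for Volterra equations with the log-convex kernel `t ^ (-α)`. -/
theorem nonneg_of_abel_volterra {α : ℝ} (hα0 : 0 < α) (hα1 : α < 1) {y w f : ℝ → ℝ}
    (hy : ContinuousOn y (Ici 0)) (hw : Continuous w) (hy0 : 0 < y 0)
    (hsign : ∀ t, 0 ≤ t → 0 ≤ y t → 0 ≤ w t)
    (hlip : ∀ T, ∃ L, ∀ t ∈ Icc 0 T, |w t| ≤ L * |y t|)
    (heq : ∀ t, 0 ≤ t → y t + ∫ s in (0:ℝ)..t, (t - s) ^ (-α) * w s = f t)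
    (hf : MonotoneOn (fun t => t ^ α * f t) (Ioi 0)) {t : ℝ} (ht : 0 ≤ t) : 0 ≤ y t := by
  have hp : -1 < -α := by linarith
  by_contra! hneg
  -- `t₀` is the infimum of the set where `y` is negative
  set S : Set ℝ := {s | 0 ≤ s ∧ y s < 0} with hS
  have hSne : S.Nonempty := ⟨t, ht, hneg⟩
  have hSbd : BddBelow S := ⟨0, fun s hs => hs.1⟩
  set t₀ := sInf S with ht₀
  have ht₀0 : 0 ≤ t₀ := le_csInf hSne fun s hs => hs.1
  have hbefore : ∀ s, 0 ≤ s → s < t₀ → 0 ≤ y s := by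
    intro s hs hst
    by_contra! h
    exact absurd (csInf_le hSbd ⟨hs, h⟩) (not_le.2 hst)
  have hyt₀le : y t₀ ≤ 0 := by
    have hmem : t₀ ∈ closure S := csInf_mem_closure hSne hSbd
    have : ContinuousWithinAt y S t₀ := (hy t₀ ht₀0).mono fun s hs => hs.1
    exact this.closure_le hmem continuousWithinAt_const fun s hs => hs.2.le
  have ht₀pos : 0 < t₀ := by
    rcases ht₀0.eq_or_lt with h | h
    · rw [← h] at hyt₀le; linarith
    · exact h
  have hyt₀ : y t₀ = 0 := by
    refine le_antisymm hyt₀le ?_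
    have h1 : t₀ ∈ closure (Ico 0 t₀) := by
      rw [closure_Ico ht₀pos.ne]; exact ⟨ht₀0, le_rfl⟩
    have : ContinuousWithinAt y (Ico 0 t₀) t₀ := (hy t₀ ht₀0).mono fun s hs => hs.1
    exact continuousWithinAt_const.closure_le h1 this fun s hs => hbefore s hs.1 hs.2
  have hwnn : ∀ s ∈ Icc 0 t₀, 0 ≤ w s := by
    intro s hs
    rcases hs.2.eq_or_lt with h | h
    · exact hsign s hs.1 (by rw [h, hyt₀])
    · exact hsign s hs.1 (hbefore s hs.1 h)
  -- `g` is the forcing term of the equation restarted at `t₀`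
  set g : ℝ → ℝ := fun τ => f τ - ∫ s in (0:ℝ)..t₀, (τ - s) ^ (-α) * w s with hg
  have hgt₀ : g t₀ = 0 := by simp only [hg, ← heq t₀ ht₀0, hyt₀]; ring
  have hint := fun c a b => intervalIntegrable_sub_rpow_mul hp c a b hw
  have hgy : ∀ τ, t₀ ≤ τ → y τ + ∫ s in t₀..τ, (τ - s) ^ (-α) * w s = g τ := by
    intro τ hτ
    have h1 := intervalIntegral.integral_add_adjacent_intervals (hint τ 0 t₀) (hint τ t₀ τ)
    have h2 := heq τ (ht₀0.trans hτ)
    simp only [hg]; linarith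
  have hgmono : ∀ τ₁ τ₂, t₀ ≤ τ₁ → τ₁ ≤ τ₂ → τ₁ ^ α * g τ₁ ≤ τ₂ ^ α * g τ₂ := by
    intro τ₁ τ₂ h1 h2
    have hτ₁ : 0 < τ₁ := ht₀pos.trans_le h1
    have hτ₂ : 0 < τ₂ := hτ₁.trans_le h2
    have h3 := hf hτ₁ hτ₂ h2
    simp only at h3
    have h4 : τ₂ ^ α * ∫ s in (0:ℝ)..t₀, (τ₂ - s) ^ (-α) * w s ≤
        τ₁ ^ α * ∫ s in (0:ℝ)..t₀, (τ₁ - s) ^ (-α) * w s := by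
      rw [← intervalIntegral.integral_const_mul, ← intervalIntegral.integral_const_mul]
      refine intervalIntegral.integral_mono_on_of_le_Ioo ht₀0 ((hint _ _ _).const_mul _)
        ((hint _ _ _).const_mul _) fun s hs => ?_
      have hs1 : 0 < τ₁ - s := by linarith [hs.2]
      have hs2 : 0 < τ₂ - s := by linarith [hs.2]
      rw [← mul_assoc, ← mul_assoc]
      refine mul_le_mul_of_nonneg_right ?_ (hwnn s ⟨hs.1.le, hs.2.le⟩)
      rw [Real.rpow_neg hs1.le, Real.rpow_neg hs2.le, ← div_eq_mul_inv, ← div_eq_mul_inv,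
        ← Real.div_rpow hτ₁.le hs1.le, ← Real.div_rpow hτ₂.le hs2.le]
      refine Real.rpow_le_rpow (by positivity) ?_ hα0.le
      rw [div_le_div_iff₀ hs2 hs1]
      nlinarith [hs.1]
    simp only [hg, mul_sub]; linarith
  obtain ⟨L₀, hL₀⟩ := hlip (t₀ + 1)
  set L := max L₀ 0 with hLdef
  have hL : ∀ t ∈ Icc 0 (t₀ + 1), |w t| ≤ L * |y t| := fun t ht =>
    (hL₀ t ht).trans (mul_le_mul_of_nonneg_right (le_max_left _ _) (abs_nonneg _))
  have hLnn : 0 ≤ L := le_max_right _ _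
  obtain ⟨ε, hε0, hε1, hεK, hε2⟩ : ∃ ε, 0 < ε ∧ ε ≤ 1 ∧ L * (ε ^ (1 - α) / (1 - α)) ≤ 1 / 4 ∧
      (t₀ + ε) ^ α ≤ 2 * t₀ ^ α := by
    have hA : Tendsto (fun ε : ℝ => L * (ε ^ (1 - α) / (1 - α))) (𝓝[>] 0) (𝓝 0) := by
      have : ContinuousAt (fun ε : ℝ => L * (ε ^ (1 - α) / (1 - α))) 0 := by
        have := Real.continuousAt_rpow_const 0 (1 - α) (Or.inr (by linarith))
        fun_prop
      have h := this.tendsto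
      rw [Real.zero_rpow (by linarith), zero_div, mul_zero] at h
      exact h.mono_left nhdsWithin_le_nhds
    have hB : Tendsto (fun ε : ℝ => (t₀ + ε) ^ α) (𝓝[>] 0) (𝓝 (t₀ ^ α)) := by
      have : Continuous (fun ε : ℝ => (t₀ + ε) ^ α) :=
        (Real.continuous_rpow_const hα0.le).comp (by fun_prop)
      have h := this.tendsto 0
      rw [add_zero] at h
      exact h.mono_left nhdsWithin_le_nhds
    have hpos : 0 < t₀ ^ α := Real.rpow_pos_of_pos ht₀pos α
    have hev := ((hA.eventually_le_const (by norm_num : (0:ℝ) < 1 / 4)).and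
      (hB.eventually_le_const (by linarith : t₀ ^ α < 2 * t₀ ^ α))).and
      (Ioo_mem_nhdsGT (zero_lt_one' ℝ))
    obtain ⟨ε, ⟨h1, h2⟩, h3⟩ := hev.exists
    exact ⟨ε, h3.1, h3.2.le, h1, h2⟩
  obtain ⟨t₁, ht₁S, ht₁lt⟩ := exists_lt_of_csInf_lt hSne (by linarith : sInf S < t₀ + ε)
  have ht₀₁ : t₀ ≤ t₁ := csInf_le hSbd ht₁S
  obtain ⟨τ, hτ, hτmax⟩ := (isCompact_Icc (a := t₀) (b := t₁)).exists_isMaxOn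
    ⟨t₀, le_rfl, ht₀₁⟩ (f := fun s => |y s|)
    ((hy.mono fun s hs => ht₀0.trans hs.1).abs)
  set M := |y τ| with hM
  have hMnn : 0 ≤ M := abs_nonneg _
  have hsmall : ∀ σ ∈ Icc t₀ t₁, |∫ s in t₀..σ, (σ - s) ^ (-α) * w s| ≤ M / 4 := by
    intro σ hσ
    have h1 : ‖∫ s in t₀..σ, (σ - s) ^ (-α) * w s‖ ≤ ∫ s in t₀..σ, (σ - s) ^ (-α) * (L * M) := by
      refine intervalIntegral.norm_integral_le_of_norm_le hσ.1 ?_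
        (intervalIntegrable_sub_rpow_mul hp σ t₀ σ continuous_const)
      refine ae_of_all _ fun s hs => ?_
      have hnn : 0 ≤ (σ - s) ^ (-α) := Real.rpow_nonneg (by linarith [hs.2]) _
      rw [norm_mul, Real.norm_of_nonneg hnn]
      refine mul_le_mul_of_nonneg_left ?_ hnn
      have hs1 : s ∈ Icc t₀ t₁ := ⟨hs.1.le, hs.2.trans hσ.2⟩
      refine (hL s ⟨ht₀0.trans hs1.1, by linarith [hs1.2]⟩).trans ?_
      exact mul_le_mul_of_nonneg_left (hτmax hs1) hLnn
    rw [intervalIntegral.integral_mul_const, integral_sub_rpow hp,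
      show -α + 1 = 1 - α by ring] at h1
    rw [← Real.norm_eq_abs]
    refine h1.trans ?_
    have h2 : (σ - t₀) ^ (1 - α) ≤ ε ^ (1 - α) :=
      Real.rpow_le_rpow (by linarith [hσ.1]) (by linarith [hσ.2]) (by linarith)
    have h3 : (σ - t₀) ^ (1 - α) / (1 - α) ≤ ε ^ (1 - α) / (1 - α) :=
      div_le_div_of_nonneg_right h2 (by linarith)
    calc (σ - t₀) ^ (1 - α) / (1 - α) * (L * M)
        ≤ ε ^ (1 - α) / (1 - α) * (L * M) := mul_le_mul_of_nonneg_right h3 (by positivity)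
      _ = L * (ε ^ (1 - α) / (1 - α)) * M := by ring
      _ ≤ 1 / 4 * M := mul_le_mul_of_nonneg_right hεK hMnn
      _ = M / 4 := by ring
  have hgnn : ∀ σ, t₀ ≤ σ → 0 ≤ g σ := by
    intro σ hσ
    have h1 := hgmono t₀ σ le_rfl hσ
    rw [hgt₀, mul_zero] at h1
    exact nonneg_of_mul_nonneg_right h1 (Real.rpow_pos_of_pos (ht₀pos.trans_le hσ) α)
  have hgτ : g τ ≤ 2 * g t₁ := by
    have hpos : 0 < t₀ ^ α := Real.rpow_pos_of_pos ht₀pos α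
    have h1 := hgmono τ t₁ hτ.1 hτ.2
    have h2 : t₀ ^ α * g τ ≤ τ ^ α * g τ :=
      mul_le_mul_of_nonneg_right (Real.rpow_le_rpow ht₀0 hτ.1 hα0.le) (hgnn τ hτ.1)
    have h3 : t₁ ^ α * g t₁ ≤ (2 * t₀ ^ α) * g t₁ :=
      mul_le_mul_of_nonneg_right ((Real.rpow_le_rpow ht₁S.1 ht₁lt.le hα0.le).trans hε2)
        (hgnn t₁ ht₀₁)
    refine le_of_mul_le_mul_left ?_ hpos
    linarith
  have hMle : M ≤ g τ + M / 4 := by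
    have h1 := hgy τ hτ.1
    have h2 := abs_le.1 (hsmall τ hτ)
    have h3 := hgnn τ hτ.1
    rw [hM]
    refine abs_le.2 ⟨?_, ?_⟩ <;> linarith [h2.1, h2.2]
  have h1 := hgy t₁ ht₀₁
  have h2 := abs_le.1 (hsmall t₁ ⟨ht₀₁, le_rfl⟩)
  have h3 := hgnn t₁ ht₀₁
  linarith [ht₁S.2, h2.2]

theorem ofReal_intervalIntegral {f : ℝ → ℝ} {a b : ℝ} (hab : a ≤ b)
    (hf : IntervalIntegrable f volume a b) (hnn : ∀ x ∈ Ioc a b, 0 ≤ f x) :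
    ENNReal.ofReal (∫ x in a..b, f x) = ∫⁻ x in Ioc a b, ENNReal.ofReal (f x) := by
  rw [intervalIntegral.integral_of_le hab]
  exact ofReal_integral_eq_lintegral_ofReal ((intervalIntegrable_iff_integrableOn_Ioc_of_le hab).1 hf)
    ((ae_restrict_iff' measurableSet_Ioc).2 (ae_of_all _ hnn))

theorem lintegral_triangle_swap {F : ℝ → ℝ → ENNReal} (hF : Measurable (Function.uncurry F)) (a b : ℝ) :
    ∫⁻ s in Ioc a b, ∫⁻ v in Ioc a s, F s v = ∫⁻ v in Ioc a b, ∫⁻ s in Ioc v b, F s v := by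
  have hT : MeasurableSet {p : ℝ × ℝ | p.2 ≤ p.1} := measurableSet_le measurable_snd measurable_fst
  set G : ℝ → ℝ → ENNReal := fun s v => {p : ℝ × ℝ | p.2 ≤ p.1}.indicator (Function.uncurry F) (s, v)
    with hG
  have hGm : Measurable (Function.uncurry G) := hF.indicator hT
  have h1 : ∀ s ∈ Ioc a b, ∫⁻ v in Ioc a s, F s v = ∫⁻ v in Ioc a b, G s v := by
    intro s hs
    have : Ioc a s = Iic s ∩ Ioc a b := by
      ext v; simp only [mem_Ioc, mem_inter_iff, mem_Iic]
      exact ⟨fun h => ⟨h.2, h.1, h.2.trans hs.2⟩, fun h => ⟨h.2.1, h.1⟩⟩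
    rw [this, ← setLIntegral_indicator measurableSet_Iic]
    refine lintegral_congr fun v => ?_
    simp only [hG, indicator, mem_Iic, mem_ofPred_eq, Function.uncurry_apply_pair]
  have h2 : ∀ v ∈ Ioc a b, ∫⁻ s in Ioc v b, F s v = ∫⁻ s in Ioc a b, G s v := by
    intro v hv
    have : Icc v b = Ici v ∩ Ioc a b := by
      ext s; simp only [mem_Ioc, mem_Icc, mem_inter_iff, mem_Ici]
      exact ⟨fun h => ⟨h.1, hv.1.trans_le h.1, h.2⟩, fun h => ⟨h.1, h.2.2⟩⟩
    rw [setLIntegral_congr (Ioc_ae_eq_Icc (a := v) (b := b)), this,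
      ← setLIntegral_indicator measurableSet_Ici]
    refine lintegral_congr fun s => ?_
    simp only [hG, indicator, mem_Ici, mem_ofPred_eq, Function.uncurry_apply_pair]
  rw [setLIntegral_congr_fun measurableSet_Ioc h1, setLIntegral_congr_fun measurableSet_Ioc h2]
  exact lintegral_lintegral_swap hGm.aemeasurable

theorem integral_sub_rpow_mul_sub_rpow {α : ℝ} (hα0 : 0 < α) (hα1 : α < 1) {v t : ℝ} (hvt : v < t) :
    ∫ s in v..t, (t - s) ^ (α - 1) * (s - v) ^ (-α) = Real.Gamma (1 - α) * Real.Gamma α := by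
  have h1 := intervalIntegral.integral_comp_sub_right (a := v) (b := t)
    (fun x : ℝ => ((t - v) - x) ^ (α - 1) * x ^ (-α)) v
  simp only [sub_sub_sub_cancel_right, sub_self] at h1
  rw [h1]
  have ha : 0 < t - v := sub_pos.2 hvt
  generalize t - v = a at ha
  have h2 := Complex.betaIntegral_scaled ((1 - α : ℝ) : ℂ) (α : ℂ) ha
  have h3 := Complex.Gamma_mul_Gamma_eq_betaIntegral (s := ((1 - α : ℝ) : ℂ)) (t := (α : ℂ))
    (by rw [Complex.ofReal_re]; linarith) (by rw [Complex.ofReal_re]; exact hα0)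
  have e1 : ((1 - α : ℝ) : ℂ) + (α : ℂ) = 1 := by push_cast; ring
  rw [e1, Complex.Gamma_one, one_mul, Complex.Gamma_ofReal, Complex.Gamma_ofReal] at h3
  rw [e1, sub_self, Complex.cpow_zero, one_mul, ← h3] at h2
  rw [← Complex.ofReal_inj, Complex.ofReal_mul, ← h2, ← intervalIntegral.integral_ofReal]
  refine intervalIntegral.integral_congr fun x hx => ?_
  rw [uIcc_of_le ha.le] at hx
  have hx2 : 0 ≤ a - x := by linarith [hx.2]
  simp only [Complex.ofReal_mul, Complex.ofReal_cpow hx2, Complex.ofReal_cpow hx.1]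
  push_cast
  rw [mul_comm]
  congr 2
  ring

/-- Inversion of the Abel transform, in integrated form. -/
theorem integral_abelTransform {α : ℝ} (hα0 : 0 < α) (hα1 : α < 1) {u : ℝ → ℝ}
    (hu : Continuous u) (hnn : ∀ s, 0 ≤ s → 0 ≤ u s) {t : ℝ} (ht : 0 ≤ t) :
    ∫ s in (0:ℝ)..t, (t - s) ^ (α - 1) * ∫ v in (0:ℝ)..s, (s - v) ^ (-α) * u v =
      Real.Gamma (1 - α) * Real.Gamma α * ∫ v in (0:ℝ)..t, u v := by
  have hp : -1 < -α := by linarith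
  have hB : 0 < Real.Gamma (1 - α) * Real.Gamma α :=
    mul_pos (Real.Gamma_pos_of_pos (by linarith)) (Real.Gamma_pos_of_pos hα0)
  have hinner : ∀ s, 0 ≤ s → 0 ≤ ∫ v in (0:ℝ)..s, (s - v) ^ (-α) * u v := fun s hs =>
    intervalIntegral.integral_nonneg hs fun v hv =>
      mul_nonneg (Real.rpow_nonneg (by linarith [hv.2]) _) (hnn v hv.1)
  have hXc : ContinuousOn (fun s => ∫ v in (0:ℝ)..s, (s - v) ^ (-α) * u v) (uIcc 0 t) :=
    (continuousOn_abelTransform hp hu).mono fun s hs => by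
      rw [uIcc_of_le ht] at hs; exact hs.1
  have hout : IntervalIntegrable
      (fun s => (t - s) ^ (α - 1) * ∫ v in (0:ℝ)..s, (s - v) ^ (-α) * u v) volume 0 t := by
    have := intervalIntegrable_sub_rpow_mul (p := α - 1) (by linarith) t 0 t
      (w := fun _ => 1) continuous_const
    simp only [mul_one] at this
    exact this.mul_continuousOn hXc
  have houtnn : ∀ s ∈ Ioc 0 t, 0 ≤ (t - s) ^ (α - 1) * ∫ v in (0:ℝ)..s, (s - v) ^ (-α) * u v :=
    fun s hs => mul_nonneg (Real.rpow_nonneg (by linarith [hs.2]) _) (hinner s hs.1.le)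
  have hl : 0 ≤ ∫ s in (0:ℝ)..t, (t - s) ^ (α - 1) * ∫ v in (0:ℝ)..s, (s - v) ^ (-α) * u v := by
    refine intervalIntegral.integral_nonneg ht fun s hs =>
      mul_nonneg (Real.rpow_nonneg (by linarith [hs.2]) _) (hinner s hs.1)
  have hr : 0 ≤ ∫ v in (0:ℝ)..t, u v := intervalIntegral.integral_nonneg ht fun v hv => hnn v hv.1
  rw [← ENNReal.ofReal_eq_ofReal_iff hl (mul_nonneg hB.le hr), ofReal_intervalIntegral ht hout houtnn]
  set F : ℝ → ℝ → ENNReal := fun s v =>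
    ENNReal.ofReal ((t - s) ^ (α - 1) * ((s - v) ^ (-α) * u v)) with hF
  have hFm : Measurable (Function.uncurry F) := by
    refine Measurable.ennreal_ofReal ?_
    exact ((measurable_const.sub measurable_fst).pow_const _).mul
      (((measurable_fst.sub measurable_snd).pow_const _).mul (hu.measurable.comp measurable_snd))
  have h1 : ∀ s ∈ Ioc 0 t,
      ENNReal.ofReal ((t - s) ^ (α - 1) * ∫ v in (0:ℝ)..s, (s - v) ^ (-α) * u v) =
        ∫⁻ v in Ioc 0 s, F s v := by
    intro s hs
    rw [← intervalIntegral.integral_const_mul, ofReal_intervalIntegral hs.1.le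
      ((intervalIntegrable_sub_rpow_mul hp s 0 s hu).const_mul _)]
    intro v hv
    exact mul_nonneg (Real.rpow_nonneg (by linarith [hs.2]) _)
      (mul_nonneg (Real.rpow_nonneg (by linarith [hv.2]) _) (hnn v hv.1.le))
  have h2 : ∀ v ∈ Ioo 0 t, ∫⁻ s in Ioc v t, F s v =
      ENNReal.ofReal (Real.Gamma (1 - α) * Real.Gamma α * u v) := by
    intro v hv
    have hI := integral_sub_rpow_mul_sub_rpow hα0 hα1 hv.2
    have hII : IntervalIntegrable (fun s => (t - s) ^ (α - 1) * (s - v) ^ (-α)) volume v t :=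
      intervalIntegral.intervalIntegrable_of_integral_ne_zero (by rw [hI]; exact hB.ne')
    rw [← hI, ← intervalIntegral.integral_mul_const,
      ofReal_intervalIntegral hv.2.le (hII.mul_const _)]
    · simp only [hF, mul_assoc]
    · intro s hs
      exact mul_nonneg (mul_nonneg (Real.rpow_nonneg (by linarith [hs.2]) _)
        (Real.rpow_nonneg (by linarith [hs.1]) _)) (hnn v hv.1.le)
  rw [setLIntegral_congr_fun measurableSet_Ioc h1, lintegral_triangle_swap hFm,
    ← setLIntegral_congr (Ioo_ae_eq_Ioc (a := (0:ℝ)) (b := t)),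
    setLIntegral_congr_fun measurableSet_Ioo h2, setLIntegral_congr (Ioo_ae_eq_Ioc (a := (0:ℝ)) (b := t)),
    ← intervalIntegral.integral_const_mul,
    ofReal_intervalIntegral ht ((hu.const_mul _).intervalIntegrable _ _)
      fun v hv => mul_nonneg hB.le (hnn v hv.1.le)]

theorem tendsto_rpow_neg_mul_abelTransform {p : ℝ} (hp : -1 < p) {X : ℝ → ℝ} {ℓ C : ℝ}
    (hX : ContinuousOn X (Ici 0)) (hC : ∀ t, 0 ≤ t → |X t| ≤ C) (hlim : Tendsto X atTop (𝓝 ℓ)) :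
    Tendsto (fun t => t ^ (-(p + 1)) * ∫ s in (0:ℝ)..t, (t - s) ^ p * X s) atTop
      (𝓝 (ℓ / (p + 1))) := by
  have hval : ∫ x in (0:ℝ)..1, x ^ p * ℓ = ℓ / (p + 1) := by
    rw [intervalIntegral.integral_mul_const, integral_rpow (Or.inl hp), Real.one_rpow,
      Real.zero_rpow (by linarith)]
    ring
  have hmain : Tendsto (fun t => ∫ x in (0:ℝ)..1, x ^ p * X (t * (1 - x))) atTop
      (𝓝 (∫ x in (0:ℝ)..1, x ^ p * ℓ)) := by
    refine intervalIntegral.tendsto_integral_filter_of_dominated_convergence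
      (fun x => x ^ p * C) ?_ ?_ ((intervalIntegral.intervalIntegrable_rpow' hp).mul_const C) ?_
    · filter_upwards [eventually_ge_atTop 0] with t ht
      rw [uIoc_of_le zero_le_one]
      refine ((measurable_id.pow_const p).aestronglyMeasurable).mul
        (ContinuousOn.aestronglyMeasurable ?_ measurableSet_Ioc)
      refine hX.comp (by fun_prop) fun x hx => mul_nonneg ht (by linarith [hx.2])
    · filter_upwards [eventually_ge_atTop 0] with t ht
      refine ae_of_all _ fun x hx => ?_
      rw [uIoc_of_le zero_le_one] at hx
      rw [norm_mul, Real.norm_of_nonneg (Real.rpow_nonneg hx.1.le p)]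
      exact mul_le_mul_of_nonneg_left (hC _ (mul_nonneg ht (by linarith [hx.2])))
        (Real.rpow_nonneg hx.1.le p)
    · filter_upwards [Measure.ae_ne volume (1:ℝ)] with x hx1 hx
      rw [uIoc_of_le zero_le_one] at hx
      have : 0 < 1 - x := sub_pos.2 (lt_of_le_of_ne hx.2 hx1)
      exact (hlim.comp (tendsto_id.atTop_mul_const this)).const_mul _
  rw [hval] at hmain
  refine hmain.congr' ?_
  filter_upwards [eventually_gt_atTop 0] with t ht
  rw [abelTransform_eq_scaled p X ht, ← mul_assoc, ← Real.rpow_add ht, neg_add_cancel,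
    Real.rpow_zero, one_mul]

/-- Monotone density theorem for power asymptotics. -/
theorem tendsto_of_antitoneOn_of_tendsto_integral {α C : ℝ} {u : ℝ → ℝ} (hu : Continuous u)
    (hanti : AntitoneOn u (Ici 0))
    (hU : Tendsto (fun t => t ^ (-α) * ∫ s in (0:ℝ)..t, u s) atTop (𝓝 C)) :
    Tendsto (fun t => t ^ (1 - α) * u t) atTop (𝓝 (α * C)) := by
  set U : ℝ → ℝ := fun t => ∫ s in (0:ℝ)..t, u s with hUdef
  have hi : ∀ a b, IntervalIntegrable u volume a b := fun a b => hu.intervalIntegrable a b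
  have hineq : ∀ c, 0 < c → ∀ t, 0 < t → U (c * t) - U t ≤ (c - 1) * t * u t := by
    intro c hc t ht
    have h1 : U (c * t) - U t = ∫ s in t..c * t, u s :=
      intervalIntegral.integral_interval_sub_left (hi _ _) (hi _ _)
    rw [h1]
    have hct : 0 < c * t := mul_pos hc ht
    rcases le_total t (c * t) with h | h
    · have := intervalIntegral.integral_mono_on h (hi _ _) (_root_.intervalIntegrable_const (c := u t))
        fun s hs => hanti ht.le (ht.le.trans hs.1) hs.1
      rw [intervalIntegral.integral_const, smul_eq_mul] at this
      linarith
    · have := intervalIntegral.integral_mono_on h (_root_.intervalIntegrable_const (c := u t)) (hi _ _)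
        fun s hs => hanti (hct.le.trans hs.1) ht.le hs.2
      rw [intervalIntegral.integral_const, smul_eq_mul] at this
      rw [intervalIntegral.integral_symm]
      linarith
  have hq : ∀ c, 0 < c → Tendsto (fun t => t ^ (-α) * (U (c * t) - U t)) atTop
      (𝓝 ((c ^ α - 1) * C)) := by
    intro c hc
    have h1 := ((hU.comp (tendsto_id.const_mul_atTop hc)).const_mul (c ^ α)).sub hU
    rw [show (c ^ α - 1) * C = c ^ α * C - C by ring]
    refine h1.congr' ?_
    filter_upwards [eventually_gt_atTop 0] with t ht
    simp only [Function.comp, id, Real.mul_rpow hc.le ht.le, ← mul_assoc, ← Real.rpow_add hc,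
      add_neg_cancel, Real.rpow_zero, one_mul, mul_sub, hUdef]
  have hpow : ∀ t : ℝ, 0 < t → t ^ (1 - α) = t ^ (-α) * t := fun t ht => by
    rw [← Real.rpow_add_one ht.ne']; ring_nf
  have hslope : Tendsto (fun c : ℝ => (c ^ α - 1) * C / (c - 1)) (𝓝[≠] 1) (𝓝 (α * C)) := by
    have h1 : HasDerivAt (fun c : ℝ => c ^ α) α 1 := by
      simpa using Real.hasDerivAt_rpow_const (x := 1) (p := α) (Or.inl one_ne_zero)
    refine ((hasDerivAt_iff_tendsto_slope.1 h1).mul_const C).congr fun c => ?_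
    rw [slope_def_field, Real.one_rpow]
    ring
  refine tendsto_order.2 ⟨fun a ha => ?_, fun a ha => ?_⟩
  · have h1 := (hslope.mono_left (nhdsGT_le_nhdsNE 1)).eventually_const_lt ha
    obtain ⟨c, hc, hc1⟩ := (h1.and self_mem_nhdsWithin).exists
    have hc1 : 0 < c - 1 := sub_pos.2 hc1
    rw [lt_div_iff₀ hc1] at hc
    filter_upwards [(hq c (by linarith)).eventually_const_lt hc, eventually_gt_atTop 0] with t h ht
    have h2 := mul_le_mul_of_nonneg_left (hineq c (by linarith) t ht) (Real.rpow_nonneg ht.le (-α))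
    rw [hpow t ht]
    refine lt_of_mul_lt_mul_right ?_ hc1.le
    linarith
  · have h1 := (hslope.mono_left (nhdsLT_le_nhdsNE 1)).eventually_lt_const ha
    obtain ⟨c, hc, hc1, hc0⟩ := (h1.and (eventually_mem_nhdsWithin.and
      (nhdsWithin_le_nhds (lt_mem_nhds (zero_lt_one' ℝ))))).exists
    have hc1 : c - 1 < 0 := sub_neg.2 hc1
    rw [div_lt_iff_of_neg hc1] at hc
    filter_upwards [(hq c hc0).eventually_const_lt hc, eventually_gt_atTop 0] with t h ht
    have h2 := mul_le_mul_of_nonneg_left (hineq c hc0 t ht) (Real.rpow_nonneg ht.le (-α))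
    rw [hpow t ht]
    refine lt_of_mul_lt_mul_right (a := 1 - c) ?_ (by linarith)
    linarith

theorem tendsto_rpow_mul_of_abel_volterra {α δ : ℝ} (hα0 : 0 < α) (hα1 : α < 1) (hδ : 0 < δ)
    {v G : ℝ → ℝ} (hv : Continuous v) (hG : Antitone G) (hGlip : LocallyLipschitz G)
    (hGδ : ∀ x, G x = 0 ↔ x = δ)
    (heq : ∀ t, 0 ≤ t → v t = G (∫ s in (0:ℝ)..t, (t - s) ^ (-α) * v s)) :
    Tendsto (fun t => t ^ (1 - α) * v t) atTop
      (𝓝 (δ / (Real.Gamma (1 - α) * Real.Gamma α))) := by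
  have hp : -1 < -α := by linarith
  set X : ℝ → ℝ := fun t => ∫ s in (0:ℝ)..t, (t - s) ^ (-α) * v s with hXdef
  have hXc : ContinuousOn X (Ici 0) := continuousOn_abelTransform hp hv
  have hX0 : X 0 = 0 := by simp [hXdef]
  have hint := fun c a b => intervalIntegrable_sub_rpow_mul hp c a b hv
  have hlip : ∀ T, ∃ L, ∀ s ∈ Icc 0 T, ∀ z ∈ X '' Icc 0 T ∪ {δ}, |v s - G z| ≤ L * |X s - z| := by
    intro T
    have hK : IsCompact (X '' Icc 0 T ∪ {δ}) :=
      (isCompact_Icc.image_of_continuousOn (hXc.mono fun s hs => hs.1)).union isCompact_singleton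
    obtain ⟨L, hL⟩ := hGlip.locallyLipschitzOn.exists_lipschitzOnWith_of_compact hK
    refine ⟨L, fun s hs z hz => ?_⟩
    have := hL.dist_le_mul (X s) (Or.inl (mem_image_of_mem X hs)) z hz
    rwa [Real.dist_eq, Real.dist_eq, ← heq s hs.1] at this
  have hGδ0 : G δ = 0 := (hGδ δ).2 rfl
  have hXδ : ∀ t, 0 ≤ t → X t ≤ δ := by
    intro t ht
    refine sub_nonneg.1 (nonneg_of_abel_volterra hα0 hα1 (y := fun t => δ - X t) (w := v)
      (f := fun _ => δ) (continuousOn_const.sub hXc) hv (by simpa [hX0] using hδ) ?_ ?_ ?_ ?_ ht)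
    · intro s hs h
      rw [heq s hs]
      exact hGδ0.symm.trans_le (hG (sub_nonneg.1 h))
    · intro T
      obtain ⟨L, hL⟩ := hlip T
      refine ⟨L, fun s hs => ?_⟩
      have := hL s hs δ (Or.inr rfl)
      rwa [hGδ0, sub_zero, abs_sub_comm] at this
    · intro s _
      exact sub_add_cancel _ _
    · intro a ha b _ hab
      exact mul_le_mul_of_nonneg_right (Real.rpow_le_rpow (le_of_lt ha) hab hα0.le) hδ.le
  have hvnn : ∀ t, 0 ≤ t → 0 ≤ v t := fun t ht => by
    rw [heq t ht]; exact hGδ0.symm.trans_le (hG (hXδ t ht))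
  have hv0 : 0 < v 0 := by
    refine lt_of_le_of_ne (hvnn 0 le_rfl) fun h => hδ.ne ?_
    rw [heq 0 le_rfl] at h
    rw [← (hGδ _).1 h.symm]
    exact hX0.symm
  have hXpos : ∀ h, 0 < h → 0 < X h := by
    intro h hh
    obtain ⟨ε, hε, hvε⟩ := Metric.eventually_nhds_iff.1 (hv.continuousAt.eventually_const_lt hv0)
    have hm : 0 < min ε h := lt_min hε hh
    have h1 := intervalIntegral.intervalIntegral_pos_of_pos_on (hint h 0 (min ε h)) (fun s hs =>
      mul_pos (Real.rpow_pos_of_pos (by linarith [hs.2, min_le_right ε h]) _) (hvε (by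
        rw [Real.dist_eq, sub_zero, abs_of_pos hs.1]
        exact hs.2.trans_le (min_le_left _ _)))) hm
    have h2 : 0 ≤ ∫ s in min ε h..h, (h - s) ^ (-α) * v s :=
      intervalIntegral.integral_nonneg (min_le_right _ _) fun s hs =>
        mul_nonneg (Real.rpow_nonneg (by linarith [hs.2]) _) (hvnn s (hm.le.trans hs.1))
    have h3 := intervalIntegral.integral_add_adjacent_intervals (hint h 0 (min ε h))
      (hint h (min ε h) h)
    simp only [hXdef]
    linarith
  have hmono : MonotoneOn X (Ici 0) := by
    intro a ha b _ hab
    rcases hab.eq_or_lt with rfl | hab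
    · exact le_rfl
    obtain ⟨h, hh, rfl⟩ : ∃ h, 0 < h ∧ b = a + h := ⟨b - a, sub_pos.2 hab, by ring⟩
    refine sub_nonneg.1 (nonneg_of_abel_volterra hα0 hα1 (y := fun t => X (t + h) - X t)
      (w := fun t => v t - v (t + h)) (f := fun t => ∫ s in (0:ℝ)..h, (t + h - s) ^ (-α) * v s)
      (ContinuousOn.sub (hXc.comp (by fun_prop) fun s (hs : 0 ≤ s) => add_nonneg hs hh.le) hXc)
      (by fun_prop) (by simpa [hX0] using hXpos h hh) ?_ ?_ ?_ ?_ ha)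
    · intro s hs hy
      rw [sub_nonneg, heq s hs, heq (s + h) (by linarith)]
      exact hG (sub_nonneg.1 hy)
    · intro T
      obtain ⟨L, hL⟩ := hlip (T + h)
      refine ⟨L, fun s hs => ?_⟩
      have hs1 : s + h ∈ Icc 0 (T + h) := ⟨by linarith [hs.1], by linarith [hs.2]⟩
      have := hL s ⟨hs.1, by linarith [hs.2]⟩ (X (s + h)) (Or.inl (mem_image_of_mem X hs1))
      rwa [← heq (s + h) hs1.1, abs_sub_comm (X s)] at this
    · intro t ht
      have h1 := intervalIntegral.integral_add_adjacent_intervals (hint (t + h) 0 h)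
        (hint (t + h) h (t + h))
      have h2 := intervalIntegral.integral_comp_add_right (a := 0) (b := t)
        (fun s => (t + h - s) ^ (-α) * v s) h
      simp only [add_sub_add_right_eq_sub, zero_add] at h2
      have h3 := intervalIntegral.integral_sub (hint t 0 t)
        (intervalIntegrable_sub_rpow_mul hp t 0 t (w := fun s => v (s + h)) (by fun_prop))
      simp only [mul_sub, hXdef]
      rw [h3, ← h1, h2]
      ring
    · intro t₁ (ht₁ : 0 < t₁) t₂ (ht₂ : 0 < t₂) ht
      simp only [← intervalIntegral.integral_const_mul]
      refine intervalIntegral.integral_mono_on_of_le_Ioo hh.le ((hint _ _ _).const_mul _)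
        ((hint _ _ _).const_mul _) fun s hs => ?_
      have hs1 : 0 < t₁ + h - s := by linarith [hs.2]
      have hs2 : 0 < t₂ + h - s := by linarith [hs.2]
      rw [← mul_assoc, ← mul_assoc]
      refine mul_le_mul_of_nonneg_right ?_ (hvnn s hs.1.le)
      rw [Real.rpow_neg hs1.le, Real.rpow_neg hs2.le, ← div_eq_mul_inv, ← div_eq_mul_inv,
        ← Real.div_rpow ht₁.le hs1.le, ← Real.div_rpow ht₂.le hs2.le]
      refine Real.rpow_le_rpow (by positivity) ?_ hα0.le
      rw [div_le_div_iff₀ hs1 hs2]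
      nlinarith [hs.2]
  have hXnn : ∀ t, 0 ≤ t → 0 ≤ X t := fun t ht => hX0 ▸ hmono self_mem_Ici ht ht
  have hanti : AntitoneOn v (Ici 0) := by
    intro a ha b hb hab
    rw [heq a ha, heq b hb]
    exact hG (hmono ha hb hab)
  obtain ⟨ℓ, hℓ⟩ : ∃ ℓ, Tendsto X atTop (𝓝 ℓ) := by
    have hm : Monotone fun t => X (max t 0) := fun a b hab =>
      hmono (mem_Ici.2 (le_max_right _ _)) (mem_Ici.2 (le_max_right _ _)) (max_le_max_right 0 hab)
    have hb : BddAbove (range fun t => X (max t 0)) :=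
      ⟨δ, forall_mem_range.2 fun t => hXδ _ (le_max_right _ _)⟩
    refine ⟨_, (tendsto_atTop_ciSup hm hb).congr' ?_⟩
    filter_upwards [eventually_ge_atTop 0] with t ht
    rw [max_eq_left ht]
  have hvlim : Tendsto v atTop (𝓝 (G ℓ)) := by
    refine ((hGlip.continuous.tendsto ℓ).comp hℓ).congr' ?_
    filter_upwards [eventually_ge_atTop 0] with t ht
    exact (heq t ht).symm
  have hvge : ∀ t, 0 ≤ t → G ℓ ≤ v t := fun t ht => le_of_tendsto hvlim (by
    filter_upwards [eventually_ge_atTop t] with s hs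
    exact hanti ht (ht.trans hs) hs)
  have hGℓ : G ℓ = 0 := by
    have h0 : 0 ≤ G ℓ := ge_of_tendsto hvlim (by
      filter_upwards [eventually_ge_atTop 0] with s hs using hvnn s hs)
    by_contra hne
    have hpos : 0 < G ℓ := lt_of_le_of_ne h0 (Ne.symm hne)
    have hlow : ∀ t, 0 ≤ t → t ^ (1 - α) * (G ℓ / (1 - α)) ≤ X t := by
      intro t ht
      have h1 := intervalIntegral.integral_mono_on_of_le_Ioo ht
        (intervalIntegrable_sub_rpow_mul hp t 0 t (w := fun _ => G ℓ) continuous_const)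
        (hint t 0 t) fun s hs => mul_le_mul_of_nonneg_left (hvge s hs.1.le)
          (Real.rpow_nonneg (by linarith [hs.2]) _)
      rw [intervalIntegral.integral_mul_const, integral_sub_rpow hp, sub_zero,
        show -α + 1 = 1 - α by ring] at h1
      calc _ = t ^ (1 - α) / (1 - α) * G ℓ := by ring
        _ ≤ X t := h1
    have h2 : Tendsto (fun t : ℝ => t ^ (1 - α) * (G ℓ / (1 - α))) atTop atTop :=
      (tendsto_rpow_atTop (by linarith)).atTop_mul_const (div_pos hpos (by linarith))
    obtain ⟨t, h3, ht⟩ := ((h2.eventually_gt_atTop δ).and (eventually_ge_atTop 0)).exists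
    linarith [hlow t ht, hXδ t ht]
  rw [(hGδ ℓ).1 hGℓ] at hℓ
  have hB : 0 < Real.Gamma (1 - α) * Real.Gamma α :=
    mul_pos (Real.Gamma_pos_of_pos (by linarith)) (Real.Gamma_pos_of_pos hα0)
  have hY := tendsto_rpow_neg_mul_abelTransform (p := α - 1) (by linarith) hXc (C := δ)
    (fun t ht => abs_le.2 ⟨by linarith [hXnn t ht], hXδ t ht⟩) hℓ
  rw [sub_add_cancel] at hY
  have hU : Tendsto (fun t => t ^ (-α) * ∫ s in (0:ℝ)..t, v s) atTop
      (𝓝 (δ / α / (Real.Gamma (1 - α) * Real.Gamma α))) := by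
    refine (hY.div_const (Real.Gamma (1 - α) * Real.Gamma α)).congr' ?_
    filter_upwards [eventually_ge_atTop 0] with t ht
    rw [integral_abelTransform hα0 hα1 hv hvnn ht, mul_left_comm, mul_div_cancel_left₀ _ hB.ne']
  have := tendsto_of_antitoneOn_of_tendsto_integral hv hanti hU
  rwa [show α * (δ / α / (Real.Gamma (1 - α) * Real.Gamma α)) =
    δ / (Real.Gamma (1 - α) * Real.Gamma α) by field_simp] at this

/-- Long-time asymptotics of the solution of the impact Volterra equation with
constant profile: `t^{1−α} (γ − r*(t)) → λ δ / (Γ(1−α) Γ(α))` as `t → ∞`,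
where `δ` is the unique positive solution of `H(δ) = γ`. -/
theorem stmt_16
    (α lam γ δ : ℝ) (hα0 : 0 < α) (hα1 : α < 1) (hlam : 0 < lam)
    (hγ : 0 < γ) (hδ : 0 < δ)
    (H : ℝ → ℝ) (hH_cont : Continuous H) (hH_conv : ConvexOn ℝ univ H)
    (hH_mono : Monotone H)
    (hH_zero : ∀ x, x ≤ 0 → H x = 0)
    (hH_diff : DifferentiableOn ℝ H (Ioi 0))
    (hH_strict : StrictMonoOn H (Ioi 0))
    (hHδ : H δ = γ)
    (r : ℝ → ℝ) (hr_cont : ContinuousOn r (Ici 0))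
    (hr_eq : ∀ t, 0 ≤ t →
      r t = H (∫ s in (0:ℝ)..t, lam⁻¹ * (t - s) ^ (-α) * (γ - r s))) :
    Tendsto (fun t => t ^ (1 - α) * (γ - r t)) atTop
      (𝓝 (lam * δ / (Real.Gamma (1 - α) * Real.Gamma α))) := by
  have hv : Continuous fun t => lam⁻¹ * (γ - r (max t 0)) := by
    have : Continuous fun t => r (max t 0) :=
      hr_cont.comp_continuous (by fun_prop) fun t => le_max_right t 0
    exact continuous_const.mul (continuous_const.sub this)
  have key := tendsto_rpow_mul_of_abel_volterra hα0 hα1 hδ hv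
    (G := fun x => lam⁻¹ * (γ - H x))
    (fun a b hab => mul_le_mul_of_nonneg_left (sub_le_sub_left (hH_mono hab) γ)
      (inv_nonneg.2 hlam.le)) ?_ ?_ ?_
  · rw [mul_div_assoc]
    refine (key.const_mul lam).congr' ?_
    filter_upwards [eventually_ge_atTop 0] with t ht
    rw [max_eq_left ht]
    field_simp
  · have : ConcaveOn ℝ univ fun x => lam⁻¹ * (γ - H x) :=
      ((concaveOn_const γ convex_univ).sub hH_conv).smul (inv_nonneg.2 hlam.le)
    exact this.locallyLipschitz
  · intro x
    rw [mul_eq_zero, or_iff_right (inv_ne_zero hlam.ne'), sub_eq_zero]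
    refine ⟨fun h => ?_, fun h => by rw [h, hHδ]⟩
    rcases le_or_gt x 0 with hx | hx
    · rw [hH_zero x hx] at h
      exact absurd h hγ.ne'
    · exact hH_strict.injOn hx hδ (h.symm.trans hHδ.symm)
  · intro t ht
    rw [max_eq_left ht, hr_eq t ht]
    congr 3
    refine intervalIntegral.integral_congr fun s hs => ?_
    rw [uIcc_of_le ht] at hs
    simp only [max_eq_left hs.1]
    ring
end
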